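/- Let n ≥ 3, G = SL(n,ℝ), Γ the image of SL(n,ℤ) in G, and B the subgroup of G consisting of all upper triangular matrices in G (the Borel subgroup). Let X be a compact Hausdorff topological space on which Γ acts by homeomorphisms, and let φ : G/B → X be a continuous surjective Γ-equivariant map (where Γ acts on G/B by left translations). Then there exists a closed subgroup P of G with B ⊆ P, and a homeomorphism e : G/P → X that is Γ-equivariant: e(γ·x) = γ·e(x) for all γ ∈ Γ and x ∈ G/P. -/

import Mathlib

open Matrix MatrixGroups

noncomputable instance {n : ℕ} : TopologicalSpace (Matrix.SpecialLinearGroup (Fin n) ℝ) :=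
  instTopologicalSpaceSubtype

/-- The image of `SL(n,ℤ)` in `SL(n,ℝ)`. -/
def SLZ (n : ℕ) : Subgroup (SL(n, ℝ)) :=
  (Matrix.SpecialLinearGroup.map (n := Fin n) (Int.castRingHom ℝ)).range

namespace Dani

open Filter Topology

variable {n : ℕ}

instance : IsTopologicalGroup (SL(n, ℝ)) := Matrix.SpecialLinearGroup.topologicalGroup

/-- block matrix -/
def blkM (i j : Fin n) (a b c d : ℝ) : Matrix (Fin n) (Fin n) ℝ :=
  Matrix.of fun r s => if r = i then (if s = i then a else if s = j then b else 0)
    else if r = j then (if s = i then c else if s = j then d else 0)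
    else if r = s then 1 else 0

lemma blkM_mul_apply {i j : Fin n} (hij : i ≠ j) (a b c d : ℝ) (M : Matrix (Fin n) (Fin n) ℝ)
    (r s : Fin n) : (blkM i j a b c d * M) r s =
      if r = i then a * M i s + b * M j s else if r = j then c * M i s + d * M j s
      else M r s := by
  have key : ∀ x y : ℝ, ∑ k, (if k = i then x else if k = j then y else 0) * M k s
      = x * M i s + y * M j s := by
    intro x y
    have : ∀ k, (if k = i then x else if k = j then y else 0) * M k s
        = (if k = i then x * M k s else 0) + (if k = j then y * M k s else 0) := by
      intro k
      by_cases h1 : k = i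
      · subst h1; simp [hij]
      · by_cases h2 : k = j <;> simp [h1, h2, hij.symm]
    simp [this, Finset.sum_add_distrib]
  rw [Matrix.mul_apply]
  simp only [blkM, Matrix.of_apply]
  by_cases h1 : r = i
  · simp only [h1, if_true]; exact key a b
  · by_cases h2 : r = j
    · simp only [h2, hij.symm, if_true, if_false]; exact key c d
    · simp [h1, h2]

lemma blkM_mul {i j : Fin n} (hij : i ≠ j) (a b c d a' b' c' d' : ℝ) :
    blkM i j a b c d * blkM i j a' b' c' d' =
      blkM i j (a*a'+b*c') (a*b'+b*d') (c*a'+d*c') (c*b'+d*d') := by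
  ext r s
  rw [blkM_mul_apply hij]
  simp only [blkM, Matrix.of_apply, hij.symm, if_true, if_false]
  split_ifs <;> simp_all

lemma blkM_det {i j : Fin n} (hij : i ≠ j) (a b c d : ℝ) :
    (blkM i j a b c d).det = a * d - b * c := by
  let U : Matrix (Fin n) (Fin 2) ℝ := Matrix.of fun r k => if k = 0 then (if r = i then 1 else 0)
    else (if r = j then 1 else 0)
  have h1 : blkM i j a b c d = 1 + U * (!![a-1, b; c, d-1] * Uᵀ) := by
    ext r s
    simp only [blkM, U, Matrix.of_apply, Matrix.add_apply, Matrix.mul_apply, Fin.sum_univ_two,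
      Matrix.transpose_apply, Matrix.one_apply]
    by_cases h1 : r = i
    · subst h1
      by_cases h2 : s = r
      · subst h2; simp [hij]
      · simp [h2, Ne.symm h2, hij]
    · by_cases h3 : r = j
      · subst h3
        by_cases h2 : s = r
        · subst h2; simp [hij.symm]
        · simp [h2, Ne.symm h2, hij.symm]
      · simp [h1, h3]
  have h2 : Uᵀ * U = 1 := by
    ext k l
    fin_cases k <;> fin_cases l <;> simp [U, Matrix.mul_apply, hij, hij.symm]
  rw [h1, Matrix.det_one_add_mul_comm, Matrix.mul_assoc, h2, Matrix.mul_one, Matrix.det_fin_two]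
  simp
  

/-- block element -/
def blk {i j : Fin n} (hij : i ≠ j) (a b c d : ℝ) (h : a * d - b * c = 1) : SL(n, ℝ) :=
  ⟨blkM i j a b c d, by rw [blkM_det hij, h]⟩

lemma blk_mul_apply {i j : Fin n} (hij : i ≠ j) (a b c d : ℝ) (h : a * d - b * c = 1)
    (g : SL(n, ℝ)) (r s : Fin n) : (blk hij a b c d h * g).1 r s =
      if r = i then a * g.1 i s + b * g.1 j s else if r = j then c * g.1 i s + d * g.1 j s
      else g.1 r s := blkM_mul_apply hij a b c d g.1 r s

lemma blk_apply {i j : Fin n} (hij : i ≠ j) (a b c d : ℝ) (h : a * d - b * c = 1)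
    (r s : Fin n) : (blk hij a b c d h).1 r s =
    if r = i then (if s = i then a else if s = j then b else 0)
    else if r = j then (if s = i then c else if s = j then d else 0)
    else if r = s then 1 else 0 := rfl

lemma blk_mul {i j : Fin n} (hij : i ≠ j) {a b c d a' b' c' d' : ℝ} (h : a * d - b * c = 1)
    (h' : a' * d' - b' * c' = 1) :
    blk hij a b c d h * blk hij a' b' c' d' h' =
      blk hij (a*a'+b*c') (a*b'+b*d') (c*a'+d*c') (c*b'+d*d') (by linear_combination h' + (a'*d'-b'*c')* h) :=
  Subtype.ext (blkM_mul hij a b c d a' b' c' d')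

lemma blk_one {i j : Fin n} (hij : i ≠ j) : blk hij 1 0 0 1 (by norm_num) = 1 := by
  apply Subtype.ext
  ext r s
  rw [blk_apply]
  simp only [Matrix.SpecialLinearGroup.coe_one, Matrix.one_apply]
  by_cases h1 : r = i
  · subst h1; by_cases h2 : s = r
    · simp [h2]
    · simp [h2, Ne.symm h2]
  · by_cases h3 : r = j
    · subst h3; by_cases h2 : s = r
      · simp [h2, h1]
      · simp [h2, Ne.symm h2, h1]
    · simp [h1, h3]

lemma blk_congr {i j : Fin n} (hij : i ≠ j) {a b c d a' b' c' d' : ℝ} (h : a * d - b * c = 1)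
    (ha : a = a') (hb : b = b') (hc : c = c') (hd : d = d') :
    blk hij a b c d h = blk hij a' b' c' d' (by subst ha hb hc hd; exact h) := by
  subst ha hb hc hd; rfl

lemma blk_inv {i j : Fin n} (hij : i ≠ j) {a b c d : ℝ} (h : a * d - b * c = 1) :
    (blk hij a b c d h)⁻¹ = blk hij d (-b) (-c) a (by linear_combination h) := by
  rw [inv_eq_iff_mul_eq_one, blk_mul, ← blk_one hij]
  apply blk_congr <;> first | ring1 | linear_combination h

lemma transvection_eq_blk {i j : Fin n} (hij : i ≠ j) (t : ℝ) :
    Matrix.SpecialLinearGroup.transvection hij t = blk hij 1 t 0 1 (by ring) := by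
  apply Subtype.ext
  ext r s
  rw [blk_apply, Matrix.SpecialLinearGroup.transvection_coe]
  simp only [Matrix.add_apply, Matrix.one_apply, Matrix.single_apply]
  by_cases h1 : r = i
  · subst h1; by_cases h2 : s = r
    · simp [h2, hij.symm]
    · simp [h2, Ne.symm h2, hij, eq_comm]
  · by_cases h3 : r = j
    · subst h3; by_cases h2 : s = r
      · simp [h2, h1, hij]
      · simp [h2, Ne.symm h2, h1, hij]
    · simp [h1, h3, Ne.symm h1]

lemma blk_swap {i j : Fin n} (hij : i ≠ j) {a b c d : ℝ} (h : a * d - b * c = 1) :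
    blk hij a b c d h = blk hij.symm d c b a (by linear_combination h) := by
  apply Subtype.ext
  ext r s
  rw [blk_apply, blk_apply]
  by_cases h1 : r = i
  · subst h1; by_cases h2 : s = r
    · simp [h2, hij]
    · simp [h2, hij]
  · by_cases h3 : r = j
    · subst h3; by_cases h2 : s = r
      · simp [h2, h1]
      · simp [h2, h1]
    · simp [h1, h3]

lemma mem_SLZ_of_int {g : SL(n, ℝ)} (h : ∀ i j, ∃ z : ℤ, g.1 i j = z) : g ∈ SLZ n := by
  choose z hz using h
  have hg : (Matrix.of z).map (Int.castRingHom ℝ) = g.1 := by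
    ext i j; simp [hz]
  refine ⟨⟨Matrix.of z, ?_⟩, ?_⟩
  · have := RingHom.map_det (Int.castRingHom ℝ) (Matrix.of z)
    rw [RingHom.mapMatrix_apply, hg, g.2] at this
    have h2 : (((Matrix.of z).det : ℤ) : ℝ) = ((1:ℤ):ℝ) := by simpa using this
    exact_mod_cast h2
  · apply Subtype.ext
    exact hg

lemma blk_mem_SLZ {i j : Fin n} (hij : i ≠ j) (a b c d : ℤ) (h : (a:ℝ) * d - b * c = 1) :
    blk hij a b c d h ∈ SLZ n := by
  apply mem_SLZ_of_int
  intro r s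
  rw [blk_apply]
  split_ifs
  exacts [⟨a, rfl⟩, ⟨b, rfl⟩, ⟨0, by simp⟩, ⟨c, rfl⟩, ⟨d, rfl⟩, ⟨0, by simp⟩, ⟨1, by simp⟩, ⟨0, by simp⟩]


lemma ne_of_adj {i j : Fin n} (h : (i:ℕ) + 1 = j) : i ≠ j := by
  rintro rfl; omega

lemma givens (Q : Subgroup (SL(n, ℝ))) (S : Set (Fin n))
    (hQ : ∀ (i j : Fin n) (h : (i:ℕ) + 1 = j), i ∈ S → ∀ (a b : ℝ) (hab : a * a - b * (-b) = 1),
      blk (ne_of_adj h) a b (-b) a hab ∈ Q)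
    (p : SL(n, ℝ)) (hp : ∀ i, i ∉ S → ∀ r s : Fin n, s ≤ i → i < r → p.1 r s = 0) :
    ∃ q ∈ Q, ∀ i j : Fin n, j < i → (q * p).1 i j = 0 := by
  have stepA : ∀ (k r : ℕ) (p : SL(n, ℝ)),
      (∀ i, i ∉ S → ∀ r s : Fin n, s ≤ i → i < r → p.1 r s = 0) →
      (∀ i j : Fin n, j < i → ((j:ℕ) < k ∨ ((j:ℕ) = k ∧ r < (i:ℕ))) → p.1 i j = 0) →
      ∃ q ∈ Q, (∀ i, i ∉ S → ∀ r s : Fin n, s ≤ i → i < r → (q * p).1 r s = 0) ∧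
        (∀ i j : Fin n, j < i → (j:ℕ) < k + 1 → (q * p).1 i j = 0) := by
    intro k r
    induction r with
    | zero =>
      intro p hp hred
      refine ⟨1, Q.one_mem, by simpa using hp, ?_⟩
      intro i j hji hj
      rw [one_mul]
      exact hred i j hji (by have : (j:ℕ) < i := hji; omega)
    | succ r ih =>
      intro p hp hred
      by_cases hrk : r + 1 ≤ k
      · refine ⟨1, Q.one_mem, by simpa using hp, ?_⟩
        intro i j hji hj
        rw [one_mul]
        exact hred i j hji (by have : (j:ℕ) < i := hji; omega)
      by_cases hrn : n ≤ r + 1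
      · apply ih p hp
        intro i j hji hj
        exact hred i j hji (by have := i.2; omega)
      push Not at hrk hrn
      let R : Fin n := ⟨r+1, hrn⟩
      let R' : Fin n := ⟨r, by omega⟩
      let K : Fin n := ⟨k, by omega⟩
      by_cases hz : p.1 R K = 0
      · apply ih p hp
        intro i j hji hj
        by_cases hi : i = R ∧ j = K
        · rw [hi.1, hi.2, hz]
        · apply hred i j hji
          have : ¬ ((i:ℕ) = r+1 ∧ (j:ℕ) = k) := fun h => hi ⟨Fin.ext h.1, Fin.ext h.2⟩
          omega
      have hadj : (R':ℕ) + 1 = R := rfl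
      have hS : R' ∈ S := by
        by_contra hS
        exact hz (hp R' hS R K (by simp only [R', K, Fin.mk_le_mk]; omega) (by simp [R', R]))
      let ρ := Real.sqrt (p.1 R' K ^ 2 + p.1 R K ^ 2)
      have hpos : 0 < p.1 R' K ^ 2 + p.1 R K ^ 2 := by positivity
      have hρ : ρ ^ 2 = p.1 R' K ^ 2 + p.1 R K ^ 2 := Real.sq_sqrt hpos.le
      have hρ0 : ρ ≠ 0 := (Real.sqrt_pos.mpr hpos).ne'
      have hab : (p.1 R' K / ρ) * (p.1 R' K / ρ) - (p.1 R K / ρ) * (-(p.1 R K / ρ)) = 1 := by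
        field_simp
        linarith
      have hq := hQ R' R hadj hS _ _ hab
      set q := blk (ne_of_adj hadj) _ _ _ _ hab with hqdef
      have hmul := blk_mul_apply (ne_of_adj hadj) _ _ _ _ hab p
      rw [← hqdef] at hmul
      obtain ⟨q', hq', h1, h2⟩ := ih (q * p) (by
        intro i hi r' s' hs hr
        rw [hmul]
        have hiR : i ≠ R' := fun h => hi (h ▸ hS)
        have hiR' : (i:ℕ) ≠ r := fun h => hiR (Fin.ext h)
        have hs' : (s':ℕ) ≤ i := hs
        have hr' : (i:ℕ) < r' := hr
        split_ifs with h1 h2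
        · have hr1 : (r':ℕ) = r := congrArg Fin.val h1
          rw [hp i hi R' s' hs (h1 ▸ hr), hp i hi R s' hs (by
            show (i:ℕ) < r + 1
            omega)]; ring
        · have hr1 : (r':ℕ) = r + 1 := congrArg Fin.val h2
          rw [hp i hi R' s' hs (by
            show (i:ℕ) < r
            omega), hp i hi R s' hs (h2 ▸ hr)]; ring
        · exact hp i hi r' s' hs hr) (by
        intro i j hji hj
        have hji' : (j:ℕ) < i := hji
        rw [hmul]
        split_ifs with h1 h2
        · have hr1 : (i:ℕ) = r := congrArg Fin.val h1
          rw [hred R' j (h1 ▸ hji) (by omega), hred R j (by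
            show (j:ℕ) < r + 1
            omega) (by omega)]; ring
        · have hr1 : (i:ℕ) = r + 1 := congrArg Fin.val h2
          rcases hj with hj | hj
          · rw [hred R' j (by
              show (j:ℕ) < r
              omega) (by omega), hred R j (h2 ▸ hji) (by omega)]; ring
          · have : j = K := Fin.ext hj.1
            rw [this]; ring
        · apply hred i j hji
          have : (i:ℕ) ≠ r+1 := fun h => h2 (Fin.ext h)
          omega)
      refine ⟨q' * q, Q.mul_mem hq' hq, ?_, ?_⟩
      · rw [mul_assoc]; exact h1
      · rw [mul_assoc]; exact h2
  have main : ∀ k : ℕ, ∃ q ∈ Q, (∀ i, i ∉ S → ∀ r s : Fin n, s ≤ i → i < r → (q * p).1 r s = 0) ∧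
        (∀ i j : Fin n, j < i → (j:ℕ) < k → (q * p).1 i j = 0) := by
    intro k
    induction k with
    | zero => exact ⟨1, Q.one_mem, by simpa using hp, by simp⟩
    | succ k ih =>
      obtain ⟨q, hq, h1, h2⟩ := ih
      obtain ⟨q', hq', h3, h4⟩ := stepA k n (q * p) h1 (by
        intro i j hji hj
        apply h2 i j hji
        have := i.2
        omega)
      refine ⟨q' * q, Q.mul_mem hq' hq, ?_, ?_⟩
      · rw [mul_assoc]; exact h3
      · rw [mul_assoc]; exact h4
  obtain ⟨q, hq, -, h⟩ := main n
  exact ⟨q, hq, fun i j hij => h i j hij j.2⟩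

/-- orthogonal elements -/
def Orth (n : ℕ) : Subgroup (SL(n, ℝ)) where
  carrier := {g | g.1 * g.1ᵀ = 1}
  one_mem' := by simp
  mul_mem' := by
    intro a b ha hb
    simp only [Set.mem_ofPred_eq, Matrix.SpecialLinearGroup.coe_mul, Matrix.transpose_mul] at *
    rw [Matrix.mul_assoc, ← Matrix.mul_assoc b.1, hb, Matrix.one_mul, ha]
  inv_mem' := by
    intro a ha
    simp only [Set.mem_ofPred_eq] at *
    have h1 : (a⁻¹).1 = a.1ᵀ := by
      have h2 : (a⁻¹).1 * a.1 = 1 := by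
        rw [← Matrix.SpecialLinearGroup.coe_mul]; simp
      calc (a⁻¹).1 = (a⁻¹).1 * (a.1 * a.1ᵀ) := by rw [ha, Matrix.mul_one]
        _ = a.1ᵀ := by rw [← Matrix.mul_assoc, h2, Matrix.one_mul]
    rw [h1, Matrix.transpose_transpose]
    exact mul_eq_one_comm.mp ha

lemma isCompact_orth : IsCompact (Orth n : Set (SL(n, ℝ))) := by
  have h : IsCompact {M : Matrix (Fin n) (Fin n) ℝ | M * Mᵀ = 1} := by
    have hc : IsCompact (Set.univ.pi fun _ : Fin n => Set.univ.pi fun _ : Fin n => Set.Icc (-1:ℝ) 1) :=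
      isCompact_univ_pi fun _ => isCompact_univ_pi fun _ => isCompact_Icc
    refine hc.of_isClosed_subset (isClosed_eq (by fun_prop) continuous_const) ?_
    intro (M : Matrix (Fin n) (Fin n) ℝ) (hM : M * Mᵀ = 1) i _ j _
    have h1 : (M * Mᵀ) i i = 1 := by rw [hM]; simp
    rw [Matrix.mul_apply] at h1
    have h2 : M i j * M i j ≤ ∑ k, M i k * Mᵀ k i :=
      Finset.single_le_sum (f := fun k => M i k * Mᵀ k i)
        (fun k _ => mul_self_nonneg (M i k)) (Finset.mem_univ j)
    rw [h1] at h2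
    constructor <;> nlinarith
  exact (Matrix.SpecialLinearGroup.isClosedEmbedding_val (n := Fin n) (R := ℝ)).isCompact_preimage h

lemma blk_mem_orth {i j : Fin n} (hij : i ≠ j) (a b : ℝ) (hab : a * a - b * (-b) = 1) :
    blk hij a b (-b) a hab ∈ Orth n := by
  show _ * _ = _
  have : (blk hij a b (-b) a hab).1ᵀ = (blk hij a (-b) b a (by linear_combination hab)).1 := by
    ext r s
    rw [Matrix.transpose_apply, blk_apply, blk_apply]
    by_cases h1 : r = i <;> by_cases h2 : s = i <;> by_cases h3 : r = j <;> by_cases h4 : s = j <;>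
      simp_all [eq_comm]
  rw [this, ← Matrix.SpecialLinearGroup.coe_mul, blk_mul, ← Matrix.SpecialLinearGroup.coe_one,
    ← blk_one hij]
  congr 1
  apply blk_congr <;> first | ring1 | linear_combination hab

lemma compactSpace_quot (B : Subgroup (SL(n, ℝ)))
    (hB : ∀ g : SL(n, ℝ), g ∈ B ↔
      ∀ i j : Fin n, j < i → (g : Matrix (Fin n) (Fin n) ℝ) i j = 0) :
    CompactSpace (SL(n, ℝ) ⧸ B) := by
  constructor
  have h : (Set.univ : Set (SL(n, ℝ) ⧸ B)) = (QuotientGroup.mk : SL(n, ℝ) → SL(n, ℝ) ⧸ B) '' (Orth n) := by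
    symm
    rw [Set.eq_univ_iff_forall]
    intro x
    obtain ⟨g, rfl⟩ := QuotientGroup.mk_surjective x
    obtain ⟨q, hq, h⟩ := givens (Orth n) Set.univ (fun i j h _ a b hab => blk_mem_orth _ a b hab) g
      (by simp)
    refine ⟨q⁻¹, (Orth n).inv_mem hq, ?_⟩
    rw [QuotientGroup.eq, inv_inv]
    exact (hB _).mpr h
  rw [h]
  exact isCompact_orth.image continuous_quotient_mk'


lemma tendsto_SL {α : Type*} {l : Filter α} {f : α → SL(n, ℝ)} {g : SL(n, ℝ)}
    (h : ∀ i j, Tendsto (fun m => (f m).1 i j) l (𝓝 (g.1 i j))) : Tendsto f l (𝓝 g) := by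
  refine tendsto_subtype_rng.mpr ?_
  refine tendsto_pi_nhds.mpr fun i => tendsto_pi_nhds.mpr fun j => h i j

lemma continuous_SL {α : Type*} [TopologicalSpace α] {f : α → SL(n, ℝ)}
    (h : ∀ i j, Continuous (fun m => (f m).1 i j)) : Continuous f := by
  rw [continuous_iff_continuousAt]
  intro x
  exact tendsto_SL fun i j => (h i j).continuousAt

lemma continuous_entry (i j : Fin n) : Continuous (fun g : SL(n, ℝ) => g.1 i j) := by
  exact (continuous_apply_apply i j).comp continuous_subtype_val

lemma gammaB_key (B : Subgroup (SL(n, ℝ)))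
    (hB : ∀ g : SL(n, ℝ), g ∈ B ↔
      ∀ i j : Fin n, j < i → (g : Matrix (Fin n) (Fin n) ℝ) i j = 0)
    {i j : Fin n} (hadj : (i:ℕ) + 1 = j) (p : SL(n, ℝ))
    (hp : ∀ r s : Fin n, s < r → (r ≠ j ∨ s ≠ i) → p.1 r s = 0) :
    p ∈ closure {x : SL(n, ℝ) | ∃ γ ∈ SLZ n, ∃ b ∈ B, x = γ * b} := by
  have hij := ne_of_adj hadj
  by_cases hs : p.1 j i = 0
  · apply subset_closure
    refine ⟨1, one_mem _, p, ?_, by simp⟩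
    rw [hB]
    intro r s hrs
    by_cases h : r ≠ j ∨ s ≠ i
    · exact hp r s hrs h
    · push Not at h
      rw [h.1, h.2, hs]
  set C2 := closure {x : SL(n, ℝ) | ∃ γ ∈ SLZ n, ∃ b ∈ B, x = γ * b} with hC2
  let f : ℝ → SL(n, ℝ) := fun ρ => blk hij 1 (ρ - p.1 i i / p.1 j i) 0 1 (by ring) * p
  have hf : Continuous f := by
    refine Continuous.mul (continuous_SL fun r s => ?_) continuous_const
    simp only [blk_apply]
    split_ifs <;> fun_prop
  have hcl : IsClosed (f ⁻¹' C2) := isClosed_closure.preimage hf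
  have hQ : ∀ q : ℚ, f q ∈ C2 := by
    intro q
    apply subset_closure
    have hcop : IsCoprime q.num (q.den : ℤ) := by
      rw [Int.isCoprime_iff_gcd_eq_one]; exact q.reduced
    obtain ⟨u, v, huv⟩ := hcop
    have hdet : (u:ℝ) * (q.num:ℤ) - (v:ℤ) * ((-(q.den:ℤ) : ℤ):ℝ) = 1 := by
      have := congrArg (Int.cast : ℤ → ℝ) huv
      push_cast at this ⊢
      linarith
    have hM := blk_mem_SLZ hij u v (-(q.den:ℤ)) q.num hdet
    refine ⟨_, inv_mem hM, blk hij _ _ _ _ hdet * f q, ?_, by group⟩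
    rw [hB]
    intro r s hrs
    rw [blk_mul_apply]
    have hden : (q.den : ℝ) ≠ 0 := by exact_mod_cast q.den_ne_zero
    have hqq : (q:ℝ) = q.num / q.den := Rat.cast_def q
    have e1 : (f q).1 i s = p.1 i s + (q - p.1 i i / p.1 j i) * p.1 j s := by
      simp only [f]; rw [blk_mul_apply]; simp
    have e2 : (f q).1 j s = p.1 j s := by
      simp only [f]; rw [blk_mul_apply]; simp [hij.symm]
    have hrs' : (s:ℕ) < r := hrs
    split_ifs with h1 h2
    · subst h1
      rw [e1, e2, hp r s hrs (Or.inr hrs.ne), hp j s (by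
        show (s:ℕ) < j
        omega) (Or.inr hrs.ne)]; ring
    · subst h2
      rw [e1, e2]
      by_cases hsi : s = i
      · subst hsi
        rw [hqq]; field_simp; push_cast; field_simp; ring
      · have : (s:ℕ) ≠ i := fun h => hsi (Fin.ext h)
        rw [hp i s (by
          show (s:ℕ) < i
          omega) (Or.inr hsi), hp r s hrs (Or.inr hsi)]; ring
    · have : (f q).1 r s = p.1 r s := by
        simp only [f]; rw [blk_mul_apply]; simp [h1, h2]
      rw [this]
      exact hp r s hrs (Or.inl h2)
  have hall : ∀ ρ : ℝ, f ρ ∈ C2 := by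
    have hd : DenseRange ((↑) : ℚ → ℝ) := Rat.denseRange_cast
    have : closure (Set.range ((↑) : ℚ → ℝ)) ⊆ f ⁻¹' C2 := by
      apply closure_minimal _ hcl
      rintro _ ⟨q, rfl⟩
      exact hQ q
    rw [hd.closure_range] at this
    exact fun ρ => this (Set.mem_univ _)
  have := hall (p.1 i i / p.1 j i)
  have h1 : f (p.1 i i / p.1 j i) = p := by
    simp only [f]
    rw [blk_congr hij (a' := 1) (b' := 0) (c' := 0) (d' := 1) _ rfl (sub_self _) rfl rfl,
      blk_one, one_mul]
  rwa [h1] at this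

lemma gammaB_dense (B : Subgroup (SL(n, ℝ)))
    (hB : ∀ g : SL(n, ℝ), g ∈ B ↔
      ∀ i j : Fin n, j < i → (g : Matrix (Fin n) (Fin n) ℝ) i j = 0)
    (C : Set (SL(n, ℝ))) (hC : IsClosed C) (hΓ : ∀ γ ∈ SLZ n, ∀ x ∈ C, γ * x ∈ C)
    (hBC : ∀ b ∈ B, b ∈ C) (g : SL(n, ℝ)) : g ∈ C := by
  set C2 := closure {x : SL(n, ℝ) | ∃ γ ∈ SLZ n, ∃ b ∈ B, x = γ * b} with hC2
  have hsub : C2 ⊆ C := by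
    apply closure_minimal _ hC
    rintro _ ⟨γ, hγ, b, hb, rfl⟩
    exact hΓ γ hγ b (hBC b hb)
  apply hsub
  have hleft : ∀ γ ∈ SLZ n, ∀ x ∈ C2, γ * x ∈ C2 := by
    intro γ hγ x hx
    have : C2 ⊆ (fun x => γ * x) ⁻¹' C2 := by
      apply closure_minimal _ (isClosed_closure.preimage (continuous_const.mul continuous_id))
      rintro _ ⟨γ', hγ', b, hb, rfl⟩
      apply subset_closure
      exact ⟨γ * γ', mul_mem hγ hγ', b, hb, by simp [mul_assoc]⟩
    exact this hx
  have hrightB : ∀ b ∈ B, ∀ x ∈ C2, x * b ∈ C2 := by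
    intro b hb x hx
    have : C2 ⊆ (fun x => x * b) ⁻¹' C2 := by
      apply closure_minimal _ (isClosed_closure.preimage (continuous_id.mul continuous_const))
      rintro _ ⟨γ', hγ', b', hb', rfl⟩
      apply subset_closure
      exact ⟨γ', hγ', b' * b, mul_mem hb' hb, by simp [mul_assoc]⟩
    exact this hx
  have hrot : ∀ (i j : Fin n) (h : (i:ℕ) + 1 = j) (a b : ℝ) (hab : a * a - b * (-b) = 1),
      ∀ x ∈ C2, x * blk (ne_of_adj h) a b (-b) a hab ∈ C2 := by
    intro i j h a b hab x hx
    set q := blk (ne_of_adj h) a b (-b) a hab with hq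
    have : C2 ⊆ (fun x => x * q) ⁻¹' C2 := by
      apply closure_minimal _ (isClosed_closure.preimage (continuous_id.mul continuous_const))
      rintro _ ⟨γ, hγ, b', hb', rfl⟩
      show γ * b' * q ∈ C2
      rw [mul_assoc]
      apply hleft γ hγ
      apply gammaB_key B hB h
      intro r s hrs hne
      rw [Matrix.SpecialLinearGroup.coe_mul, Matrix.mul_apply]
      apply Finset.sum_eq_zero
      intro k _
      by_cases hk : k < r
      · rw [(hB b').mp hb' r k hk, zero_mul]
      · have hrs' : (s:ℕ) < r := hrs
        have hk' : (r:ℕ) ≤ k := not_lt.mp hk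
        have h0 : q.1 k s = 0 := by
          rw [hq, blk_apply]
          split_ifs with h1 h2 h3 h4 h5 h6 h7
          · subst h1; subst h2; omega
          · subst h1; subst h3; omega
          · rfl
          · subst h4; subst h5
            exfalso
            have : r = k := Fin.ext (by omega)
            simp [this] at hne
          · subst h4; subst h6; omega
          · rfl
          · subst h7; omega
          · rfl
        rw [h0, mul_zero]
    exact this hx
  let Q : Subgroup (SL(n, ℝ)) :=
    { carrier := {q | ∀ x ∈ C2, x * q ∈ C2 ∧ x * q⁻¹ ∈ C2}
      one_mem' := by intro x hx; simpa using hx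
      mul_mem' := by
        intro a b ha hb x hx
        rw [_root_.mul_inv_rev, ← mul_assoc, ← mul_assoc]
        exact ⟨(hb _ (ha x hx).1).1, (ha _ (hb x hx).2).2⟩
      inv_mem' := by
        intro a ha x hx
        rw [inv_inv]
        exact (ha x hx).symm }
  obtain ⟨q, hq, hup⟩ := givens Q Set.univ (by
    intro i j h _ a b hab x hx
    refine ⟨hrot i j h a b hab x hx, ?_⟩
    rw [blk_inv]
    have := hrot i j h a (-b) (by linear_combination hab) x hx
    exact this) g (by simp)
  have h1 : (1 : SL(n, ℝ)) ∈ C2 := subset_closure ⟨1, one_mem _, 1, one_mem _, by simp⟩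
  have h2 : q⁻¹ ∈ C2 := by simpa using (hq 1 h1).2
  have h3 := hrightB (q * g) ((hB _).mpr hup) _ h2
  simpa using h3


/-- diagonal elements -/
def dg (D : Fin n → ℝ) (h : ∏ k, D k = 1) : SL(n, ℝ) :=
  ⟨Matrix.diagonal D, by rw [Matrix.det_diagonal, h]⟩

lemma dg_apply (D : Fin n → ℝ) (h : ∏ k, D k = 1) (r s : Fin n) :
    (dg D h).1 r s = if r = s then D r else 0 := by
  show Matrix.diagonal D r s = _
  rw [Matrix.diagonal_apply]

/-- contracting families -/
def Good (i j : Fin n) (x : ℝ) : Prop :=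
  ∃ (γ L U : ℕ → SL(n, ℝ)) (D : ℕ → Fin n → ℝ) (hD : ∀ m, ∏ k, D m k = 1),
    (∀ m, γ m ∈ SLZ n) ∧ (∀ m k, 0 < D m k) ∧ (∀ m, γ m = L m * dg (D m) (hD m) * U m) ∧
    Tendsto L atTop (𝓝 1) ∧ Tendsto U atTop (𝓝 1) ∧
    (∀ m r s, s < r → (U m).1 r s = 0) ∧ (∀ m r, (U m).1 r r = 1) ∧ (∀ m, (U m).1 i j = 0) ∧
    (∀ k l : Fin n, (k:ℕ) + 1 = l → k ≠ i → Tendsto (fun m => D m l / D m k) atTop (𝓝 0)) ∧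
    Tendsto (fun m => D m i / D m j) atTop (𝓝 x)

/-- the integers -/
noncomputable def TT (N i : ℕ) (x : ℝ) (m k : ℕ) : ℕ :=
  if k = i then ⌈x * ((m:ℝ)+1)^(N-i)⌉₊ else (m+1)^(N+1-k)

lemma TT_pos (N i : ℕ) {x : ℝ} (hx : 0 < x) (m k : ℕ) : 0 < TT N i x m k := by
  unfold TT
  split_ifs
  · apply Nat.ceil_pos.mpr; positivity
  · positivity

lemma tendsto_M : Tendsto (fun m : ℕ => (m:ℝ)+1) atTop atTop :=
  tendsto_atTop_add_const_right _ _ tendsto_natCast_atTop_atTop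

lemma tendsto_Minv (e : ℕ) (he : 0 < e) : Tendsto (fun m : ℕ => 1 / ((m:ℝ)+1)^e) atTop (𝓝 0) := by
  have := ((tendsto_pow_atTop (α := ℝ) he.ne').comp tendsto_M).inv_tendsto_atTop
  refine this.congr fun m => ?_
  simp

lemma tendsto_ceil {x : ℝ} (hx : 0 < x) (e : ℕ) (he : 0 < e) :
    Tendsto (fun m : ℕ => (⌈x * ((m:ℝ)+1)^e⌉₊ : ℝ) / ((m:ℝ)+1)^e) atTop (𝓝 x) :=
  (tendsto_nat_ceil_mul_div_atTop hx.le).comp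
    ((tendsto_pow_atTop (α := ℝ) he.ne').comp tendsto_M)

lemma TT_inv (N i : ℕ) (hi : i + 1 < N) {x : ℝ} (hx : 0 < x) (k : ℕ) (hk : k < N) :
    Tendsto (fun m => 1 / (TT N i x m k : ℝ)) atTop (𝓝 0) := by
  unfold TT
  by_cases h : k = i
  · simp only [h, if_true]
    have h1 := (tendsto_ceil hx (N-i) (by omega)).inv₀ hx.ne'
    have h2 := h1.mul (tendsto_Minv (N-i) (by omega))
    rw [mul_zero] at h2
    refine h2.congr fun m => ?_
    have : ((m:ℝ)+1)^(N-i) ≠ 0 := by positivity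
    field_simp
  · simp only [h, if_false]
    push_cast
    exact tendsto_Minv _ (by omega)

lemma good0 (N : ℕ) (i j : Fin (N+1)) (hij : (i:ℕ) + 1 = j) (hj : (j:ℕ) < N) (x : ℝ) (hx : 0 < x) :
  ∃ (γ L U : ℕ → SL(N+1, ℝ)) (D : ℕ → Fin (N+1) → ℝ) (hD : ∀ m, ∏ k, D m k = 1),
    (∀ m, γ m ∈ SLZ (N+1)) ∧ (∀ m k, 0 < D m k) ∧ (∀ m, γ m = L m * dg (D m) (hD m) * U m) ∧
    Tendsto L atTop (𝓝 1) ∧ Tendsto U atTop (𝓝 1) ∧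
    (∀ m r s, s ≠ Fin.last N → (U m).1 r s = if r = s then 1 else 0) ∧
    (∀ m, (U m).1 (Fin.last N) (Fin.last N) = 1) ∧
    (∀ k l : Fin (N+1), (k:ℕ) + 1 = l → k ≠ i → Tendsto (fun m => D m l / D m k) atTop (𝓝 0)) ∧
    Tendsto (fun m => D m i / D m j) atTop (𝓝 x) := by
  have hiN : (i:ℕ) + 1 < N := by omega
  let T : ℕ → ℕ → ℝ := fun m k => (TT N i x m k : ℝ)
  have hT : ∀ m k, 0 < T m k := fun m k => by
    show (0:ℝ) < (TT N i x m k : ℝ)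
    exact_mod_cast TT_pos N i hx m k
  let P : ℕ → ℕ → ℝ := fun m k => ∏ l ∈ Finset.range k, T m l
  have hP : ∀ m k, 0 < P m k := fun m k => Finset.prod_pos fun l _ => hT m l
  have hPs : ∀ m k, P m (k+1) = P m k * T m k := fun m k => Finset.prod_range_succ _ _
  have hPinv : ∀ k, 0 < k → k ≤ N → Tendsto (fun m => 1 / P m k) atTop (𝓝 0) := by
    intro k hk hkN
    have : Tendsto (fun m => ∏ l ∈ Finset.range k, (1 / T m l)) atTop
        (𝓝 (∏ l ∈ Finset.range k, (0:ℝ))) := by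
      apply tendsto_finset_prod
      intro l hl
      rw [Finset.mem_range] at hl
      exact TT_inv N i hiN hx l (by omega)
    rw [Finset.prod_const, Finset.card_range, zero_pow hk.ne'] at this
    refine this.congr fun m => ?_
    rw [Finset.prod_div_distrib, Finset.prod_const_one]
  let D : ℕ → Fin (N+1) → ℝ := fun m k => if (k:ℕ) < N then T m k else 1 / P m N
  have hDlt : ∀ m (k : Fin (N+1)), (k:ℕ) < N → D m k = T m k := fun m k hk => if_pos hk
  have hDge : ∀ m (k : Fin (N+1)), ¬ (k:ℕ) < N → D m k = 1 / P m N := fun m k hk => if_neg hk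
  have hD : ∀ m, ∏ k, D m k = 1 := by
    intro m
    rw [Fin.prod_univ_castSucc]
    have h1 : ∀ k : Fin N, D m k.castSucc = T m k := fun k => hDlt m _ (by simp)
    rw [hDge m (Fin.last N) (by simp)]
    simp only [h1]
    have h2 : P m N = ∏ k : Fin N, T m k := Finset.prod_range _
    rw [← h2]
    have := (hP m N).ne'
    field_simp
  have hDpos : ∀ m k, 0 < D m k := by
    intro m k
    by_cases h : (k:ℕ) < N
    · rw [hDlt m k h]; exact hT m k
    · rw [hDge m k h]; exact one_div_pos.mpr (hP m N)
  let LM : ℕ → Matrix (Fin (N+1)) (Fin (N+1)) ℝ := fun m => Matrix.of fun r s =>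
    if r = s then 1 else if (r:ℕ) = s + 1 then 1 / D m s else 0
  have hLdet : ∀ m, (LM m).det = 1 := by
    intro m
    rw [Matrix.det_of_lowerTriangular]
    · simp [LM]
    · intro r s hrs
      have hrs : (r:ℕ) < s := hrs
      have h1 : r ≠ s := fun h => by simp [h] at hrs
      have h2 : (r:ℕ) ≠ s + 1 := by omega
      simp [LM, h1, h2]
  let UM : ℕ → Matrix (Fin (N+1)) (Fin (N+1)) ℝ := fun m => Matrix.of fun r s =>
    if r = s then 1 else if (s:ℕ) = N then (-1)^(N+(r:ℕ)) / P m (r+1) else 0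
  have hUdet : ∀ m, (UM m).det = 1 := by
    intro m
    rw [Matrix.det_of_upperTriangular]
    · simp [UM]
    · intro r s hrs
      have hrs : (s:ℕ) < r := hrs
      have h1 : r ≠ s := fun h => by simp [h] at hrs
      have h2 : (s:ℕ) ≠ N := by omega
      simp [UM, h1, h2]
  let L : ℕ → SL(N+1, ℝ) := fun m => ⟨LM m, hLdet m⟩
  let U : ℕ → SL(N+1, ℝ) := fun m => ⟨UM m, hUdet m⟩
  refine ⟨fun m => L m * dg (D m) (hD m) * U m, L, U, D, hD, ?_, hDpos, fun m => rfl, ?_, ?_, ?_, ?_, ?_, ?_⟩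
  · intro m
    apply mem_SLZ_of_int
    have hUint : ∀ r s : Fin (N+1), (s:ℕ) ≠ N → UM m r s = if r = s then 1 else 0 := by
      intro r s hs
      simp [UM, hs]
    have hLD : ∀ r k : Fin (N+1), (LM m * Matrix.diagonal (D m)) r k =
        if r = k then D m r else if (r:ℕ) = k + 1 then 1 else 0 := by
      intro r k
      rw [Matrix.mul_diagonal]
      simp only [LM, Matrix.of_apply]
      have := (hDpos m k).ne'
      split_ifs with h1 h2
      · rw [h1, one_mul]
      · field_simp
      · rw [zero_mul]
    intro r s
    have hval : (L m * dg (D m) (hD m) * U m).1 r s =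
      ∑ k, (if r = k then D m r else if (r:ℕ) = k + 1 then 1 else 0) * UM m k s := by
      show ((LM m * Matrix.diagonal (D m)) * UM m) r s = _
      rw [Matrix.mul_apply]
      simp only [hLD]
    rw [hval]
    by_cases hr : (r:ℕ) = 0
    · have : ∀ k : Fin (N+1), (if r = k then D m r else if (r:ℕ) = k + 1 then 1 else 0) * UM m k s
          = if r = k then D m r * UM m k s else 0 := by
        intro k
        by_cases h : r = k
        · simp [h]
        · simp [h, hr]
      simp only [this, Finset.sum_ite_eq, Finset.mem_univ, if_true]
      by_cases hs : (s:ℕ) = N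
      · have hrs : r ≠ s := by intro h; rw [h] at hr; omega
        refine ⟨(-1)^(N+(r:ℕ)), ?_⟩
        simp only [UM, Matrix.of_apply, hrs, if_false, hs, if_true]
        rw [hDlt m r (by omega), hPs, hr]
        have : P m 0 = 1 := by simp [P]
        rw [this]
        have := (hT m 0).ne'
        push_cast
        field_simp
      · rw [hUint r s hs]
        refine ⟨if r = s then TT N i x m r else 0, ?_⟩
        rw [hDlt m r (by omega)]
        split_ifs <;> simp [T]
    · let r' : Fin (N+1) := ⟨(r:ℕ) - 1, by omega⟩
      have hr' : (r':ℕ) + 1 = r := by simp only [r']; omega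
      have hrr' : r ≠ r' := fun h => by
        have := congrArg Fin.val h
        omega
      have : ∀ k : Fin (N+1), (if r = k then D m r else if (r:ℕ) = k + 1 then 1 else 0) * UM m k s
          = (if r = k then D m r * UM m k s else 0) + (if r' = k then UM m k s else 0) := by
        intro k
        by_cases h : r = k
        · subst h
          simp [hrr'.symm]
        · by_cases h2 : r' = k
          · subst h2
            simp [h, hr']
          · have : (r:ℕ) ≠ k + 1 := fun h3 => h2 (Fin.ext (by omega))
            simp [h, h2, this]
      simp only [this, Finset.sum_add_distrib, Finset.sum_ite_eq, Finset.mem_univ, if_true]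
      by_cases hs : (s:ℕ) = N
      · refine ⟨0, ?_⟩
        have hr's : r' ≠ s := fun h => by
          have := congrArg Fin.val h
          omega
        have e2 : UM m r' s = (-1)^(N+(r':ℕ)) / P m r := by
          simp only [UM, Matrix.of_apply, hr's, if_false, hs, if_true, hr']
        rw [e2]
        have hsign : (-1:ℝ)^(N+(r:ℕ)) = - (-1)^(N+(r':ℕ)) := by
          rw [← hr', ← add_assoc, pow_succ]; ring
        by_cases hrs : r = s
        · have e1 : UM m r s = 1 := by simp [UM, hrs]
          have hrN : (r:ℕ) = N := by rw [hrs, hs]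
          rw [e1, hDge m r (by omega)]
          have h3 : (-1:ℝ)^(N+(r:ℕ)) = 1 := by
            rw [hrN, ← two_mul, pow_mul]; norm_num
          rw [hsign] at h3
          rw [hrN]
          have h4 : (-1:ℝ)^(N+(r':ℕ)) = -1 := by linarith
          rw [h4]
          push_cast
          ring
        · have e1 : UM m r s = (-1)^(N+(r:ℕ)) / P m (r+1) := by
            simp only [UM, Matrix.of_apply, hrs, if_false, hs, if_true]
          have : (r:ℕ) ≠ N := fun h => hrs (Fin.ext (by omega))
          rw [e1, hDlt m r (by omega), hsign, hPs]
          have h5 := (hT m r).ne'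
          have h6 := (hP m r).ne'
          push_cast
          field_simp
          ring
      · rw [hUint r s hs, hUint r' s hs]
        refine ⟨(if r = s then TT N i x m r else 0) + (if r' = s then 1 else 0), ?_⟩
        by_cases h : r = s
        · have : (r:ℕ) < N := by rw [h]; omega
          rw [hDlt m r this]
          simp [h, T]
        · simp [h]
  · apply tendsto_SL
    intro r s
    show Tendsto (fun m => LM m r s) _ _
    rw [Matrix.SpecialLinearGroup.coe_one, Matrix.one_apply]
    simp only [LM, Matrix.of_apply]
    split_ifs with h1 h2
    · exact tendsto_const_nhds
    · have : (s:ℕ) < N := by omega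
      simp only [hDlt _ s this]
      exact TT_inv N i hiN hx s this
    · exact tendsto_const_nhds
  · apply tendsto_SL
    intro r s
    show Tendsto (fun m => UM m r s) _ _
    rw [Matrix.SpecialLinearGroup.coe_one, Matrix.one_apply]
    simp only [UM, Matrix.of_apply]
    split_ifs with h1 h2
    · exact tendsto_const_nhds
    · have : (r:ℕ) ≠ s := fun h => h1 (Fin.ext h)
      have h3 := (hPinv (r+1) (by omega) (by omega)).const_mul ((-1)^(N+(r:ℕ)))
      rw [mul_zero] at h3
      refine h3.congr fun m => ?_
      ring
    · exact tendsto_const_nhds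
  · intro m r s hs
    have : (s:ℕ) ≠ N := fun h => hs (Fin.ext h)
    show UM m r s = _
    simp [UM, this]
  · intro m
    show UM m _ _ = _
    simp [UM]
  · intro k l hkl hki
    have hkN : (k:ℕ) < N := by omega
    have hki' : (k:ℕ) ≠ i := fun h => hki (Fin.ext h)
    simp only [hDlt _ k hkN]
    by_cases hl : (l:ℕ) < N
    · simp only [hDlt _ l hl, T, TT, hki', if_false]
      by_cases hli : (l:ℕ) = i
      · simp only [hli, if_true]
        have h1 := (tendsto_ceil hx (N-i) (by omega)).mul (tendsto_Minv 2 (by omega))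
        rw [mul_zero] at h1
        refine h1.congr fun m => ?_
        have : N + 1 - (k:ℕ) = N - i + 2 := by omega
        rw [this]
        push_cast
        rw [pow_add]
        field_simp
      · simp only [hli, if_false]
        refine (tendsto_Minv 1 (by omega)).congr fun m => ?_
        have : N + 1 - (k:ℕ) = N + 1 - l + 1 := by omega
        rw [this]
        push_cast
        rw [pow_add]
        field_simp
    · simp only [hDge _ l hl]
      have h1 := (hPinv N (by omega) le_rfl).mul (TT_inv N i hiN hx k hkN)
      rw [mul_zero] at h1
      refine h1.congr fun m => ?_
      simp only [T]
      ring
  · have hiN' : (i:ℕ) < N := by omega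
    have hji : (j:ℕ) ≠ i := by omega
    simp only [hDlt _ i hiN', hDlt _ j hj, T, TT, hji, if_false, if_true]
    refine (tendsto_ceil hx (N-i) (by omega)).congr fun m => ?_
    have : N + 1 - (j:ℕ) = N - i := by omega
    rw [this]
    push_cast
    rfl


/-- the dual automorphism -/
def th (g : SL(n, ℝ)) : SL(n, ℝ) :=
  ⟨((g⁻¹).1ᵀ).submatrix Fin.revPerm Fin.revPerm, by
    rw [Matrix.det_submatrix_equiv_self, Matrix.det_transpose]; exact (g⁻¹).2⟩

lemma th_apply (g : SL(n, ℝ)) (r s : Fin n) : (th g).1 r s = (g⁻¹).1 s.rev r.rev := rfl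

lemma th_mul (g h : SL(n, ℝ)) : th (g * h) = th g * th h := by
  apply Subtype.ext
  show ((((g * h)⁻¹).1)ᵀ).submatrix _ _ = ((g⁻¹).1ᵀ).submatrix _ _ * ((h⁻¹).1ᵀ).submatrix _ _
  rw [Matrix.submatrix_mul_equiv, ← Matrix.transpose_mul, _root_.mul_inv_rev,
    Matrix.SpecialLinearGroup.coe_mul]

lemma th_one : th (1 : SL(n, ℝ)) = 1 := by
  have := th_mul (1 : SL(n, ℝ)) 1
  simpa using this

lemma th_continuous : Continuous (th : SL(n, ℝ) → SL(n, ℝ)) := by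
  apply continuous_SL
  intro r s
  simp only [th_apply]
  exact (continuous_entry _ _).comp continuous_inv

lemma SLZ_int {g : SL(n, ℝ)} (hg : g ∈ SLZ n) (i j : Fin n) : ∃ z : ℤ, g.1 i j = z := by
  obtain ⟨z, rfl⟩ := hg
  exact ⟨z.1 i j, by simp⟩

lemma th_SLZ {g : SL(n, ℝ)} (hg : g ∈ SLZ n) : th g ∈ SLZ n := by
  apply mem_SLZ_of_int
  intro i j
  exact SLZ_int (inv_mem hg) _ _

lemma dg_inv (D : Fin n → ℝ) (hD : ∏ k, D k = 1) (hpos : ∀ k, 0 < D k) :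
    (dg D hD)⁻¹ = dg (fun k => (D k)⁻¹) (by rw [Finset.prod_inv_distrib, hD, inv_one]) := by
  rw [inv_eq_iff_mul_eq_one]
  apply Subtype.ext
  show Matrix.diagonal D * Matrix.diagonal _ = 1
  rw [Matrix.diagonal_mul_diagonal, ← Matrix.diagonal_one]
  congr 1
  ext k
  exact mul_inv_cancel₀ (hpos k).ne'

lemma th_dg (D : Fin n → ℝ) (hD : ∏ k, D k = 1) (hpos : ∀ k, 0 < D k)
    (hD' : ∏ k : Fin n, (D k.rev)⁻¹ = 1) :
    th (dg D hD) = dg (fun k => (D k.rev)⁻¹) hD' := by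
  apply Subtype.ext
  ext r s
  rw [th_apply, dg_inv D hD hpos, dg_apply, dg_apply]
  by_cases h : r = s
  · simp [h]
  · have : s.rev ≠ r.rev := fun h' => h (Fin.rev_injective h').symm
    simp [h, this]

lemma good_all (hn : 3 ≤ n) (i j : Fin n) (hij : (i:ℕ) + 1 = j) (x : ℝ) (hx : 0 < x) :
    Good i j x := by
  obtain ⟨N, rfl⟩ : ∃ N, n = N + 1 := ⟨n - 1, by omega⟩
  by_cases hj : (j:ℕ) < N
  · obtain ⟨γ, L, U, D, hD, h1, h2, h3, h4, h5, h6, h7, h8, h9⟩ := good0 N i j hij hj x hx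
    refine ⟨γ, L, U, D, hD, h1, h2, h3, h4, h5, ?_, ?_, ?_, h8, h9⟩
    · intro m r s hrs
      have hrs' : (s:ℕ) < r := hrs
      rw [h6 m r s (fun h => by rw [h] at hrs'; simp at hrs'; omega), if_neg hrs.ne']
    · intro m r
      by_cases hr : r = Fin.last N
      · rw [hr, h7]
      · rw [h6 m r r hr, if_pos rfl]
    · intro m
      rw [h6 m i j (fun h => by rw [h] at hj; simp at hj), if_neg (ne_of_adj hij)]
  · let i0 : Fin (N+1) := ⟨0, by omega⟩
    let j0 : Fin (N+1) := ⟨1, by omega⟩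
    obtain ⟨γ, L, U, D, hD, h1, h2, h3, h4, h5, h6, h7, h8, h9⟩ := good0 N i0 j0 rfl
      (by show 1 < N; omega) x hx
    have hD' : ∀ m, ∏ k : Fin (N+1), (D m k.rev)⁻¹ = 1 := by
      intro m
      rw [Finset.prod_inv_distrib, inv_eq_one, ← hD m]
      exact Equiv.prod_comp Fin.revPerm (D m)
    have hV : ∀ m r s, s ≠ Fin.last N → ((U m)⁻¹).1 r s = if r = s then 1 else 0 := by
      intro m r s hs
      have hmul : ((U m)⁻¹).1 * (U m).1 = 1 := by
        rw [← Matrix.SpecialLinearGroup.coe_mul]; simp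
      have := congrFun (congrFun hmul r) s
      rw [Matrix.mul_apply, Matrix.one_apply] at this
      rw [← this]
      simp [h6 m _ s hs]
    have hVl : ∀ m, ((U m)⁻¹).1 (Fin.last N) (Fin.last N) = 1 := by
      intro m
      have hmul : ((U m)⁻¹).1 * (U m).1 = 1 := by
        rw [← Matrix.SpecialLinearGroup.coe_mul]; simp
      have := congrFun (congrFun hmul (Fin.last N)) (Fin.last N)
      rw [Matrix.mul_apply, Matrix.one_apply, if_pos rfl, Finset.sum_eq_single (Fin.last N)] at this
      · rwa [h7, mul_one] at this
      · intro k _ hk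
        rw [hV m _ k hk, if_neg hk.symm, zero_mul]
      · simp
    have hrev : ∀ r : Fin (N+1), (r.rev : ℕ) = N - r := by
      intro r; rw [Fin.val_rev]; omega
    refine ⟨fun m => th (γ m), fun m => th (L m), fun m => th (U m), fun m k => (D m k.rev)⁻¹, hD',
      fun m => th_SLZ (h1 m), fun m k => inv_pos.mpr (h2 m _), ?_, ?_, ?_, ?_, ?_, ?_, ?_, ?_⟩
    · intro m
      show th (γ m) = _
      rw [h3, th_mul, th_mul, th_dg _ _ (h2 m) (hD' m)]
    · have := (th_continuous.tendsto (1 : SL(N+1, ℝ))).comp h4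
      rwa [th_one] at this
    · have := (th_continuous.tendsto (1 : SL(N+1, ℝ))).comp h5
      rwa [th_one] at this
    · intro m r s hrs
      have hrs' : (s:ℕ) < r := hrs
      rw [th_apply, hV, if_neg]
      · exact fun h => hrs.ne (Fin.rev_injective h)
      · intro h
        have := congrArg Fin.val h
        rw [hrev] at this
        simp at this; omega
    · intro m r
      rw [th_apply]
      by_cases hr : r.rev = Fin.last N
      · rw [hr, hVl]
      · rw [hV m _ _ hr, if_pos rfl]
    · intro m
      rw [th_apply, hV, if_neg]
      · exact fun h => (ne_of_adj hij).symm (Fin.rev_injective h)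
      · intro h
        have := congrArg Fin.val h
        rw [hrev] at this
        simp at this; omega
    · intro k l hkl hki
      have hkl2 : (k:ℕ) ≠ i := fun h => hki (Fin.ext h)
      refine (h8 l.rev k.rev (by rw [hrev, hrev]; omega) ?_).congr fun m => ?_
      · intro h
        have := congrArg Fin.val h
        rw [hrev] at this
        simp only [i0] at this; omega
      · rw [inv_div_inv]
    · have e1 : i.rev = j0 := Fin.ext (by rw [hrev]; show _ = 1; omega)
      have e2 : j.rev = i0 := Fin.ext (by rw [hrev]; show _ = 0; omega)
      simp only [e1, e2]
      refine h9.congr fun m => ?_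
      rw [inv_div_inv]


/-- upper triangular -/
def UT (g : SL(n, ℝ)) : Prop := ∀ i j : Fin n, j < i → g.1 i j = 0

lemma ut_mul_diag {g h : SL(n, ℝ)} (hg : UT g) (hh : UT h) (r : Fin n) :
    (g * h).1 r r = g.1 r r * h.1 r r := by
  rw [Matrix.SpecialLinearGroup.coe_mul, Matrix.mul_apply, Finset.sum_eq_single r]
  · intro k _ hk
    rcases lt_or_gt_of_ne hk with h1 | h1
    · rw [hg r k h1, zero_mul]
    · rw [hh k r h1, mul_zero]
  · simp

lemma ut_mul_adj {g h : SL(n, ℝ)} (hg : UT g) (hh : UT h) {i j : Fin n} (hij : (i:ℕ) + 1 = j) :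
    (g * h).1 i j = g.1 i i * h.1 i j + g.1 i j * h.1 j j := by
  rw [Matrix.SpecialLinearGroup.coe_mul, Matrix.mul_apply, Finset.sum_eq_add i j (ne_of_adj hij)]
  · intro k _ hk
    by_cases h1 : k < i
    · rw [hg i k h1, zero_mul]
    · have h1 : (i:ℕ) ≤ k := not_lt.mp h1
      have h2 : (k:ℕ) ≠ i := fun h => hk.1 (Fin.ext h)
      have h3 : (k:ℕ) ≠ j := fun h => hk.2 (Fin.ext h)
      rw [hh k j (by
        show (j:ℕ) < k
        omega), mul_zero]
  · simp
  · simp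

lemma blk_ut {i j : Fin n} (hij : (i:ℕ) + 1 = j) (a b d : ℝ) (h : a * d - b * 0 = 1) :
    UT (blk (ne_of_adj hij) a b 0 d h) := by
  intro r s hrs
  have hrs : (s:ℕ) < r := hrs
  rw [blk_apply]
  split_ifs with h1 h2 h3 h4 h5 h6 h7
  · subst h1; subst h2; omega
  · subst h1; subst h3; omega
  · rfl
  · rfl
  · subst h4; subst h6; omega
  · rfl
  · subst h7; omega
  · rfl

lemma ut_diag_ne {B : Subgroup (SL(n, ℝ))} (hB : ∀ g : SL(n, ℝ), g ∈ B ↔ UT g) {g : SL(n, ℝ)}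
    (hg : g ∈ B) (r : Fin n) : g.1 r r ≠ 0 := by
  have h1 := ut_mul_diag ((hB g).mp hg) ((hB _).mp (inv_mem hg)) r
  rw [mul_inv_cancel, Matrix.SpecialLinearGroup.coe_one, Matrix.one_apply_eq] at h1
  intro h
  rw [h, zero_mul] at h1
  exact one_ne_zero h1

/-- the subgroup H -/
def HH (B : Subgroup (SL(n, ℝ))) (hB : ∀ g : SL(n, ℝ), g ∈ B ↔ UT g) {i j : Fin n}
    (hij : (i:ℕ) + 1 = j) : Subgroup (SL(n, ℝ)) where
  carrier := {h | h ∈ B ∧ h.1 i j = 0 ∧ h.1 i i = h.1 j j}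
  one_mem' := ⟨one_mem _, by
    simp [Matrix.one_apply, ne_of_adj hij]⟩
  mul_mem' := by
    rintro a b ⟨ha, ha1, ha2⟩ ⟨hb, hb1, hb2⟩
    refine ⟨mul_mem ha hb, ?_, ?_⟩
    · rw [ut_mul_adj ((hB a).mp ha) ((hB b).mp hb) hij, ha1, hb1]; ring
    · rw [ut_mul_diag ((hB a).mp ha) ((hB b).mp hb), ut_mul_diag ((hB a).mp ha) ((hB b).mp hb),
        ha2, hb2]
  inv_mem' := by
    rintro a ⟨ha, ha1, ha2⟩
    have hua := (hB a).mp ha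
    have hui := (hB _).mp (inv_mem ha)
    have e1 := ut_mul_diag hua hui i
    have e2 := ut_mul_diag hua hui j
    have e3 := ut_mul_adj hua hui hij
    rw [mul_inv_cancel, Matrix.SpecialLinearGroup.coe_one, Matrix.one_apply_eq] at e1 e2
    rw [mul_inv_cancel, Matrix.SpecialLinearGroup.coe_one, Matrix.one_apply_ne (ne_of_adj hij),
      ha1, zero_mul, add_zero] at e3
    have hne := ut_diag_ne hB ha i
    refine ⟨inv_mem ha, ?_, ?_⟩
    · rcases mul_eq_zero.mp e3.symm with h | h
      · exact absurd h hne
      · exact h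
    · rw [← ha2] at e2
      exact mul_left_cancel₀ hne (e1.symm.trans e2)

lemma mem_HH {B : Subgroup (SL(n, ℝ))} (hB : ∀ g : SL(n, ℝ), g ∈ B ↔ UT g) {i j : Fin n}
    (hij : (i:ℕ) + 1 = j) (h : SL(n, ℝ)) :
    h ∈ HH B hB hij ↔ h ∈ B ∧ h.1 i j = 0 ∧ h.1 i i = h.1 j j := Iff.rfl

lemma HH_conj {B : Subgroup (SL(n, ℝ))} (hB : ∀ g : SL(n, ℝ), g ∈ B ↔ UT g) {i j : Fin n}
    (hij : (i:ℕ) + 1 = j) {h b : SL(n, ℝ)} (hh : h ∈ HH B hB hij) (hb : b ∈ B) :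
    b⁻¹ * h * b ∈ HH B hB hij := by
  obtain ⟨h1, h2, h3⟩ := hh
  have hk : b⁻¹ * h * b ∈ B := mul_mem (mul_mem (inv_mem hb) h1) hb
  have hkeq : b * (b⁻¹ * h * b) = h * b := by group
  set k := b⁻¹ * h * b
  have hub := (hB b).mp hb
  have huk := (hB k).mp hk
  have huh := (hB h).mp h1
  have e1 := ut_mul_diag hub huk i
  have e2 := ut_mul_diag hub huk j
  have e3 := ut_mul_adj hub huk hij
  rw [hkeq, ut_mul_diag huh hub] at e1 e2
  rw [hkeq, ut_mul_adj huh hub hij, h2] at e3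
  have n1 := ut_diag_ne hB hb i
  have n2 := ut_diag_ne hB hb j
  have f1 : k.1 i i = h.1 i i := mul_left_cancel₀ n1 (by linarith)
  have f2 : k.1 j j = h.1 j j := mul_left_cancel₀ n2 (by linarith)
  refine ⟨hk, ?_, by rw [f1, f2, h3]⟩
  rw [f2, ← h3] at e3
  have : b.1 i i * k.1 i j = 0 := by linarith
  exact (mul_eq_zero.mp this).resolve_left n1

lemma ut_prod_diag {g : SL(n, ℝ)} (hg : UT g) : ∏ k, g.1 k k = 1 := by
  have h : g.1.det = ∏ k, g.1 k k := Matrix.det_of_isUpperTriangular (fun r s hrs => hg r s hrs)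
  exact h.symm.trans g.2

lemma dense_H {B : Subgroup (SL(n, ℝ))} (hB : ∀ g : SL(n, ℝ), g ∈ B ↔ UT g) {i j : Fin n}
    (hij : (i:ℕ) + 1 = j) (hgood : ∀ x : ℝ, 0 < x → Good i j x)
    (K : Set (SL(n, ℝ))) (hK : IsClosed K) (hΓ : ∀ γ ∈ SLZ n, ∀ x ∈ K, γ * x ∈ K)
    (hH : ∀ h ∈ HH B hB hij, ∀ x ∈ K, x * h ∈ K) (h1K : 1 ∈ K) (g : SL(n, ℝ)) : g ∈ K := by
  set C := closure {x : SL(n, ℝ) | ∃ γ ∈ SLZ n, ∃ b ∈ HH B hB hij, x = γ * b} with hC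
  have hsub : C ⊆ K := by
    apply closure_minimal _ hK
    rintro _ ⟨γ, hγ, b, hb, rfl⟩
    apply hΓ γ hγ
    simpa using hH b hb 1 h1K
  apply hsub
  have hleft : ∀ γ ∈ SLZ n, ∀ x ∈ C, γ * x ∈ C := by
    intro γ hγ x hx
    have : C ⊆ (fun x => γ * x) ⁻¹' C := by
      apply closure_minimal _ (isClosed_closure.preimage (continuous_const.mul continuous_id))
      rintro _ ⟨γ', hγ', b, hb, rfl⟩
      apply subset_closure
      exact ⟨γ * γ', mul_mem hγ hγ', b, hb, by simp [mul_assoc]⟩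
    exact this hx
  have hrightH : ∀ b ∈ HH B hB hij, ∀ x ∈ C, x * b ∈ C := by
    intro b hb x hx
    have : C ⊆ (fun x => x * b) ⁻¹' C := by
      apply closure_minimal _ (isClosed_closure.preimage (continuous_id.mul continuous_const))
      rintro _ ⟨γ', hγ', b', hb', rfl⟩
      apply subset_closure
      exact ⟨γ', hγ', b' * b, mul_mem hb' hb, by simp [mul_assoc]⟩
    exact this hx
  have hmulC : ∀ q1 ∈ C, ∀ q2 ∈ C, q2 ∈ B → q1 * q2 ∈ C := by
    intro q1 hq1 q2 hq2 hq2B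
    have : C ⊆ (fun x => x * q2) ⁻¹' C := by
      apply closure_minimal _ (isClosed_closure.preimage (continuous_id.mul continuous_const))
      rintro _ ⟨γ, hγ, h, hh, rfl⟩
      have e : γ * h * q2 = γ * (q2 * (q2⁻¹ * h * q2)) := by group
      show γ * h * q2 ∈ C
      rw [e]
      exact hleft γ hγ _ (hrightH _ (HH_conj hB hij hh hq2B) _ hq2)
    exact this hq1
  have hΓC : ∀ γ ∈ SLZ n, γ ∈ C := fun γ hγ => subset_closure ⟨γ, hγ, 1, one_mem _, by simp⟩
  have nij := ne_of_adj hij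
  have hdd : ∀ s : ℝ, s ≠ 0 → s * s⁻¹ - 0 * 0 = 1 := fun s hs => by
    rw [mul_inv_cancel₀ hs]; ring
  have hd : ∀ s : ℝ, ∀ hs : 0 < s, blk nij s 0 0 s⁻¹ (hdd s hs.ne') ∈ C := by
    intro s hs
    obtain ⟨γ, L, U, D, hD, h1, h2, h3, h4, h5, h6, h7, h8, h9, h10⟩ := hgood (s^2) (by positivity)
    have hpos : ∀ m, 0 < Real.sqrt (D m i / D m j) := fun m =>
      Real.sqrt_pos.mpr (div_pos (h2 m i) (h2 m j))
    let d : ℕ → SL(n, ℝ) := fun m => blk nij (Real.sqrt (D m i / D m j)) 0 0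
      (Real.sqrt (D m i / D m j))⁻¹ (hdd _ (hpos m).ne')
    have hlim : Tendsto (fun m => Real.sqrt (D m i / D m j)) atTop (𝓝 s) := by
      have := (Real.continuous_sqrt.tendsto (s^2)).comp h10
      rwa [Real.sqrt_sq hs.le] at this
    have hdlim : Tendsto d atTop (𝓝 (blk nij s 0 0 s⁻¹ (hdd s hs.ne'))) := by
      apply tendsto_SL
      intro r t
      simp only [d, blk_apply]
      split_ifs
      · exact hlim
      · exact tendsto_const_nhds
      · exact tendsto_const_nhds
      · exact tendsto_const_nhds
      · exact hlim.inv₀ hs.ne'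
      · exact tendsto_const_nhds
      · exact tendsto_const_nhds
      · exact tendsto_const_nhds
    have hlim2 : Tendsto (fun m => L m * d m) atTop (𝓝 (blk nij s 0 0 s⁻¹ (hdd s hs.ne'))) := by
      have := h4.mul hdlim
      rwa [one_mul] at this
    refine isClosed_closure.mem_of_tendsto hlim2 (Eventually.of_forall fun m => ?_)
    apply subset_closure
    have hdgUT : UT (dg (D m) (hD m)) := by
      intro r t hrt
      rw [dg_apply, if_neg hrt.ne']
    have ha : (d m)⁻¹ * dg (D m) (hD m) ∈ HH B hB hij := by
      have hdm : d m ∈ B := (hB _).mpr (blk_ut hij _ _ _ _)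
      refine ⟨mul_mem (inv_mem hdm) ((hB _).mpr hdgUT), ?_, ?_⟩
      · simp only [d]
        rw [blk_inv, blk_mul_apply]
        simp [dg_apply, nij]
      · simp only [d]
        rw [blk_inv, blk_mul_apply, blk_mul_apply]
        simp only [dg_apply, nij, nij.symm, if_true, if_false]
        have e1 := Real.sq_sqrt (div_pos (h2 m i) (h2 m j)).le
        have := (hpos m).ne'
        have := (h2 m j).ne'
        have e2 : D m i = Real.sqrt (D m i / D m j) ^ 2 * D m j := by rw [e1]; field_simp
        generalize Real.sqrt (D m i / D m j) = w at *
        rw [e2]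
        field_simp
        ring
    have hU : U m ∈ HH B hB hij := ⟨(hB _).mpr fun r t hrt => h6 m r t hrt, h8 m, by
      rw [h7, h7]⟩
    refine ⟨γ m, h1 m, ((d m)⁻¹ * dg (D m) (hD m) * U m)⁻¹, inv_mem (mul_mem ha hU), ?_⟩
    rw [h3]
    group
  have hu : ∀ y : ℝ, blk nij 1 y 0 1 (by ring) ∈ C := by
    intro y
    have key : ∀ (s : ℝ) (e : ℤ), 0 < s → blk nij 1 (s^2 * e) 0 1 (by ring) ∈ C := by
      intro s e hs
      have m1 := hd s hs
      have m2 := hd s⁻¹ (inv_pos.mpr hs)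
      have m3 : blk nij ((1:ℤ):ℝ) (e:ℝ) ((0:ℤ):ℝ) ((1:ℤ):ℝ) (by push_cast; ring) ∈ C :=
        hΓC _ (blk_mem_SLZ nij 1 e 0 1 (by push_cast; ring))
      have m4 := hmulC _ (hmulC _ m1 _ m3 (by
        rw [blk_congr nij (a' := 1) (b' := (e:ℝ)) (c' := 0) (d' := 1) _ (by simp) rfl (by simp) (by simp)]
        exact (hB _).mpr (blk_ut hij _ _ _ _))) _ m2 ((hB _).mpr (blk_ut hij _ _ _ _))
      rw [blk_mul, blk_mul] at m4
      convert m4 using 1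
      have := hs.ne'
      apply blk_congr
      · field_simp; simp
      · field_simp; simp; ring
      · simp
      · field_simp; simp
    rcases lt_trichotomy y 0 with h | h | h
    · have := key (Real.sqrt (-y)) (-1) (Real.sqrt_pos.mpr (by linarith))
      convert this using 1
      apply blk_congr <;> try rfl
      rw [Real.sq_sqrt (by linarith)]; push_cast; ring
    · subst h
      rw [blk_one]
      exact hΓC 1 (one_mem _)
    · have := key (Real.sqrt y) 1 (Real.sqrt_pos.mpr h)
      convert this using 1
      apply blk_congr <;> try rfl
      rw [Real.sq_sqrt h.le]; push_cast; ring
  apply gammaB_dense B hB C isClosed_closure hleft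
  intro b hb
  have hub := (hB b).mp hb
  have hne := ut_diag_ne hB hb
  have hsprod : ∏ k, (SignType.sign (b.1 k k) : ℝ) = 1 := by
    have h2 : SignType.sign (∏ k, b.1 k k) = 1 := by rw [ut_prod_diag hub]; simp
    have h3 : (signHom : ℝ →*₀ SignType) (∏ k, b.1 k k) = ∏ k, signHom (b.1 k k) := map_prod _ _ _
    have h4 : ∏ k, SignType.sign (b.1 k k) = 1 := h3.symm.trans h2
    have h5 := congrArg (SignType.castHom (α := ℝ)) h4
    rw [map_prod] at h5
    simpa using h5
  set σ := dg (fun k => (SignType.sign (b.1 k k) : ℝ)) hsprod with hσ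
  have hσΓ : σ ∈ SLZ n := by
    apply mem_SLZ_of_int
    intro r s
    rw [hσ, dg_apply]
    split_ifs
    · exact ⟨(SignType.sign (b.1 r r) : ℤ), by simp⟩
    · exact ⟨0, by simp⟩
  have hσUT : UT σ := by
    intro r t hrt
    rw [hσ, dg_apply, if_neg hrt.ne']
  have hσB : σ ∈ B := (hB _).mpr hσUT
  suffices hb' : σ * b ∈ C by
    have := hleft _ (inv_mem hσΓ) _ hb'
    simpa using this
  have hpos : ∀ r, 0 < (σ * b).1 r r := by
    intro r
    rw [ut_mul_diag hσUT hub, hσ, dg_apply, if_pos rfl, sign_mul_self]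
    exact abs_pos.mpr (hne r)
  have hbB : σ * b ∈ B := mul_mem hσB hb
  set b' := σ * b
  set s := Real.sqrt (b'.1 i i / b'.1 j j) with hs
  have hspos : 0 < s := Real.sqrt_pos.mpr (div_pos (hpos i) (hpos j))
  have hs2 : s^2 = b'.1 i i / b'.1 j j := Real.sq_sqrt (div_pos (hpos i) (hpos j)).le
  have m1 := hmulC _ (hd s hspos) _ (hu (b'.1 i j / b'.1 i i)) ((hB _).mpr (blk_ut hij _ _ _ _))
  rw [blk_mul] at m1
  set q := blk nij _ _ _ _ _ with hq
  have hqB : q ∈ B := by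
    rw [hq]
    refine (hB _).mpr ?_
    rw [blk_congr nij _ (b' := s * (b'.1 i j / b'.1 i i)) (a' := s) (c' := 0) (d' := s⁻¹) (by ring)
      (by ring) (by ring) (by ring)]
    exact blk_ut hij _ _ _ _
  have hh : q⁻¹ * b' ∈ HH B hB hij := by
    have hp1 := (hpos i).ne'
    have hp2 := (hpos j).ne'
    have hp3 := hspos.ne'
    have hji : b'.1 j i = 0 := (hB _).mp hbB j i (by
      show (i:ℕ) < j
      omega)
    refine ⟨mul_mem (inv_mem hqB) hbB, ?_, ?_⟩
    · rw [hq, blk_inv, blk_mul_apply]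
      simp only [if_true]
      have : b'.1 i i = s^2 * b'.1 j j := by rw [hs2]; field_simp
      rw [this]
      field_simp
      ring
    · rw [hq, blk_inv, blk_mul_apply, blk_mul_apply]
      simp only [if_true, nij.symm, if_false, hji]
      have : b'.1 i i = s^2 * b'.1 j j := by rw [hs2]; field_simp
      rw [this]
      field_simp
      ring
  have := hrightH _ hh _ m1
  simpa using this


/-- elementary -/
def el {i j : Fin n} (hij : i ≠ j) (t : ℝ) : SL(n, ℝ) := blk hij 1 t 0 1 (by ring)

lemma el_zero {i j : Fin n} (hij : i ≠ j) : el hij 0 = 1 := blk_one hij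

lemma diag2n_eq_blk {i j : Fin n} (hij : i ≠ j) (c : ℝ) (hc : c ≠ 0) :
    Matrix.SpecialLinearGroup.diag2n hij c hc = blk hij c 0 0 c⁻¹ (by
      rw [mul_inv_cancel₀ hc]; ring) := by
  apply Subtype.ext
  ext r s
  rw [blk_apply, Matrix.SpecialLinearGroup.diag2n_coe, Matrix.diagonal_apply]
  by_cases h1 : r = s
  · subst h1
    by_cases h2 : r = i <;> by_cases h3 : r = j <;> simp_all
  · by_cases h2 : r = i
    · subst h2; simp [h1, Ne.symm h1]
    · by_cases h3 : r = j
      · subst h3; simp [h1, h2, Ne.symm h1]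
      · simp [h1, h2, h3]

lemma el_induction (hn : 3 ≤ n) (P : SL(n, ℝ) → Prop)
    (hel : ∀ (i j : Fin n) (hij : i ≠ j) (t : ℝ), P (el hij t))
    (hmul : ∀ A B, P A → P B → P (A * B)) (g : SL(n, ℝ)) : P g := by
  have : Nontrivial (Fin n) := Fin.nontrivial_iff_two_le.mpr (by omega)
  refine Matrix.SpecialLinearGroup.diagonal_transvection_induction' P g ?_ ?_ hmul
  · intro i j hij c hc
    have hlow : ∀ t, P (blk hij 1 0 t 1 (by ring)) := by
      intro t
      rw [blk_swap]
      exact hel j i hij.symm t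
    have hup : ∀ t, P (blk hij 1 t 0 1 (by ring)) := hel i j hij
    have h := hmul _ _ (hmul _ _ (hmul _ _ (hmul _ _ (hup c) (hlow (-c⁻¹))) (hup (c-1))) (hlow 1)) (hup (-1))
    rw [blk_mul, blk_mul, blk_mul, blk_mul] at h
    rw [diag2n_eq_blk]
    convert h using 1
    apply blk_congr
    all_goals field_simp; try ring
  · intro i j hij t
    rw [transvection_eq_blk]
    exact hel i j hij t

/-- polynomial functions -/
def Pol (f : SL(n, ℝ) → ℝ) : Prop :=
  ∀ (g₁ g₂ : SL(n, ℝ)) (i j : Fin n) (hij : i ≠ j), ∃ p : Polynomial ℝ, ∀ t,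
    f (g₁ * el hij t * g₂) = p.eval t

lemma Pol.const (c : ℝ) : Pol (fun _ : SL(n, ℝ) => c) :=
  fun _ _ _ _ _ => ⟨Polynomial.C c, fun t => by simp⟩

lemma Pol.add {f g : SL(n, ℝ) → ℝ} (hf : Pol f) (hg : Pol g) : Pol (fun x => f x + g x) := by
  intro g₁ g₂ i j hij
  obtain ⟨p, hp⟩ := hf g₁ g₂ i j hij
  obtain ⟨q, hq⟩ := hg g₁ g₂ i j hij
  exact ⟨p + q, fun t => by simp [hp, hq]⟩

lemma Pol.mul {f g : SL(n, ℝ) → ℝ} (hf : Pol f) (hg : Pol g) : Pol (fun x => f x * g x) := by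
  intro g₁ g₂ i j hij
  obtain ⟨p, hp⟩ := hf g₁ g₂ i j hij
  obtain ⟨q, hq⟩ := hg g₁ g₂ i j hij
  exact ⟨p * q, fun t => by simp [hp, hq]⟩

lemma Pol.sub {f g : SL(n, ℝ) → ℝ} (hf : Pol f) (hg : Pol g) : Pol (fun x => f x - g x) := by
  intro g₁ g₂ i j hij
  obtain ⟨p, hp⟩ := hf g₁ g₂ i j hij
  obtain ⟨q, hq⟩ := hg g₁ g₂ i j hij
  exact ⟨p - q, fun t => by simp [hp, hq]⟩

lemma Pol.sum {ι : Type*} (s : Finset ι) {f : ι → SL(n, ℝ) → ℝ} (hf : ∀ i, Pol (f i)) :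
    Pol (fun x => ∑ i ∈ s, f i x) := by
  intro g₁ g₂ i j hij
  choose p hp using fun k => hf k g₁ g₂ i j hij
  exact ⟨∑ i ∈ s, p i, fun t => by simp [hp, Polynomial.eval_finsetSum]⟩

lemma Pol.prod {ι : Type*} (s : Finset ι) {f : ι → SL(n, ℝ) → ℝ} (hf : ∀ i, Pol (f i)) :
    Pol (fun x => ∏ i ∈ s, f i x) := by
  intro g₁ g₂ i j hij
  choose p hp using fun k => hf k g₁ g₂ i j hij
  exact ⟨∏ i ∈ s, p i, fun t => by simp [hp, Polynomial.eval_prod]⟩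

lemma Pol.right {f : SL(n, ℝ) → ℝ} (hf : Pol f) (h : SL(n, ℝ)) : Pol (fun x => f (x * h)) := by
  intro g₁ g₂ i j hij
  obtain ⟨p, hp⟩ := hf g₁ (g₂ * h) i j hij
  exact ⟨p, fun t => by
    rw [← hp]
    show f (g₁ * el hij t * g₂ * h) = _
    rw [mul_assoc (g₁ * el hij t)]⟩

lemma Pol.entry (r s : Fin n) : Pol (fun x : SL(n, ℝ) => x.1 r s) := by
  intro g₁ g₂ i j hij
  have h : ∀ k, ∃ p : Polynomial ℝ, ∀ t, (el hij t * g₂).1 k s = p.eval t := by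
    intro k
    simp only [el, blk_mul_apply]
    split_ifs
    · exact ⟨Polynomial.C (g₂.1 i s) + Polynomial.X * Polynomial.C (g₂.1 j s), fun t => by simp; ring⟩
    · exact ⟨Polynomial.C (g₂.1 j s), fun t => by simp⟩
    · exact ⟨Polynomial.C (g₂.1 k s), fun t => by simp⟩
  choose p hp using h
  refine ⟨∑ k, Polynomial.C (g₁.1 r k) * p k, fun t => ?_⟩
  show (g₁ * el hij t * g₂).1 r s = _
  rw [mul_assoc, Matrix.SpecialLinearGroup.coe_mul, Matrix.mul_apply, Polynomial.eval_finsetSum]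
  simp [← hp]

lemma Pol.det {M : SL(n, ℝ) → Matrix (Fin n) (Fin n) ℝ} (hM : ∀ r s, Pol (fun x => M x r s)) :
    Pol (fun x => (M x).det) := by
  simp only [Matrix.det_apply']
  exact Pol.sum _ fun σ => (Pol.const _).mul (Pol.prod _ fun k => hM _ _)

lemma Pol.adj {M : SL(n, ℝ) → Matrix (Fin n) (Fin n) ℝ} (hM : ∀ r s, Pol (fun x => M x r s))
    (i j : Fin n) : Pol (fun x => (M x).adjugate i j) := by
  simp only [Matrix.adjugate_apply]
  apply Pol.det
  intro r s
  simp only [Matrix.updateRow_apply]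
  split_ifs
  · exact Pol.const _
  · exact hM r s

lemma exists_nat_eval_ne {p : Polynomial ℝ} (hp : p ≠ 0) : ∃ k : ℕ, p.eval (k:ℝ) ≠ 0 := by
  by_contra h
  push Not at h
  apply hp
  apply Polynomial.eq_zero_of_infinite_isRoot
  exact Set.infinite_of_injective_forall_mem (f := fun k : ℕ => (k:ℝ)) Nat.cast_injective h

lemma el_mem_SLZ {i j : Fin n} (hij : i ≠ j) (k : ℕ) : el hij (k:ℝ) ∈ SLZ n := by
  have := blk_mem_SLZ hij 1 k 0 1 (by push_cast; ring)
  convert this using 1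
  apply blk_congr <;> simp

lemma gen_key (hn : 3 ≤ n) (e : SL(n, ℝ)) : ∀ e' : SL(n, ℝ),
    (∀ γ ∈ SLZ n, ∀ f₁ f₂ : SL(n, ℝ) → ℝ, Pol f₁ → Pol f₂ → f₁ γ ≠ 0 → f₂ (γ * e') ≠ 0 →
      ∃ γ' ∈ SLZ n, f₁ γ' ≠ 0 ∧ f₂ γ' ≠ 0) →
    (∀ γ ∈ SLZ n, ∀ f₁ f₂ : SL(n, ℝ) → ℝ, Pol f₁ → Pol f₂ → f₁ γ ≠ 0 → f₂ (γ * (e * e')) ≠ 0 →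
      ∃ γ' ∈ SLZ n, f₁ γ' ≠ 0 ∧ f₂ γ' ≠ 0) := by
  induction e using el_induction hn with
  | hel i j hij t =>
    intro e' he' γ hγ f₁ f₂ hf₁ hf₂ h1 h2
    obtain ⟨p, hp⟩ := hf₁ γ 1 i j hij
    obtain ⟨q, hq⟩ := hf₂ γ e' i j hij
    have hp0 : p ≠ 0 := by
      rintro rfl
      have := hp 0
      rw [el_zero] at this
      simp at this
      exact h1 this
    have hq0 : q ≠ 0 := by
      rintro rfl
      have := hq t
      rw [mul_assoc] at this
      simp at this
      exact h2 this
    obtain ⟨k, hk⟩ := exists_nat_eval_ne (mul_ne_zero hp0 hq0)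
    rw [Polynomial.eval_mul, ← hp, ← hq, mul_one] at hk
    exact he' (γ * el hij k) (mul_mem hγ (el_mem_SLZ hij k)) f₁ f₂ hf₁ hf₂ (left_ne_zero_of_mul hk)
      (right_ne_zero_of_mul hk)
  | hmul A B hA hB =>
    intro e' he'
    rw [mul_assoc]
    exact hA _ (hB _ he')

lemma gen_two (hn : 3 ≤ n) {f₁ f₂ : SL(n, ℝ) → ℝ} (hf₁ : Pol f₁) (hf₂ : Pol f₂)
    (h1 : ∃ γ ∈ SLZ n, f₁ γ ≠ 0) (h2 : ∃ g, f₂ g ≠ 0) :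
    ∃ γ' ∈ SLZ n, f₁ γ' ≠ 0 ∧ f₂ γ' ≠ 0 := by
  obtain ⟨γ, hγ, h1⟩ := h1
  obtain ⟨g, h2⟩ := h2
  refine gen_key hn (γ⁻¹ * g) 1 ?_ γ hγ f₁ f₂ hf₁ hf₂ h1 (by simpa using h2)
  intro γ hγ f₁ f₂ _ _ h1 h2
  exact ⟨γ, hγ, h1, by simpa using h2⟩

lemma gen_mul (hn : 3 ≤ n) {f₁ f₂ : SL(n, ℝ) → ℝ} (hf₁ : Pol f₁) (hf₂ : Pol f₂)
    (h1 : ∃ γ ∈ SLZ n, f₁ γ ≠ 0) (h2 : ∃ g, f₂ g ≠ 0) :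
    ∃ γ' ∈ SLZ n, f₁ γ' * f₂ γ' ≠ 0 := by
  obtain ⟨γ, hγ, h1, h2⟩ := gen_two hn hf₁ hf₂ h1 h2
  exact ⟨γ, hγ, mul_ne_zero h1 h2⟩

lemma gen_prod (hn : 3 ≤ n) {ι : Type*} [DecidableEq ι] (s : Finset ι) {f : ι → SL(n, ℝ) → ℝ} (hf : ∀ i, Pol (f i))
    (h : ∀ i, ∃ g, f i g ≠ 0) : ∃ γ ∈ SLZ n, ∏ i ∈ s, f i γ ≠ 0 := by
  induction s using Finset.induction_on with
  | empty => exact ⟨1, one_mem _, by simp⟩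
  | insert a s ha ih =>
    obtain ⟨γ, hγ, h'⟩ := gen_mul hn (Pol.prod s hf) (hf a) ih (h a)
    refine ⟨γ, hγ, ?_⟩
    rw [Finset.prod_insert ha, mul_comm]
    exact h'


/-- truncated matrices -/
def AA (k : Fin n) (g : SL(n, ℝ)) : Matrix (Fin n) (Fin n) ℝ :=
  Matrix.of fun r s => if r ≤ k then g.1 r s else if r = s then 1 else 0

lemma AA_apply (k : Fin n) (g : SL(n, ℝ)) (r s : Fin n) :
    AA k g r s = if r ≤ k then g.1 r s else if r = s then 1 else 0 := rfl

lemma AA_continuous (k : Fin n) : Continuous (AA k : SL(n, ℝ) → Matrix (Fin n) (Fin n) ℝ) := by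
  refine continuous_pi fun r => continuous_pi fun s => ?_
  simp only [AA_apply]
  split_ifs
  · exact continuous_entry r s
  · exact continuous_const
  · exact continuous_const

/-- the triangularising matrix -/
noncomputable def cM (g : SL(n, ℝ)) : Matrix (Fin n) (Fin n) ℝ :=
  Matrix.of fun s k => (AA k g).adjugate s k / (AA k g).det

lemma cM_spec {g : SL(n, ℝ)} {k : Fin n} (hk : (AA k g).det ≠ 0) (r : Fin n) :
    ∑ s, AA k g r s * cM g s k = if r = k then 1 else 0 := by
  have h := congrFun (congrFun (Matrix.mul_adjugate (AA k g)) r) k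
  rw [Matrix.mul_apply, Matrix.smul_apply, Matrix.one_apply] at h
  simp only [cM, Matrix.of_apply, mul_div_assoc', ← Finset.sum_div]
  rw [h]
  split_ifs <;> simp [hk]

lemma cM_upper {g : SL(n, ℝ)} {k : Fin n} (hk : (AA k g).det ≠ 0) {r : Fin n} (hr : k < r) :
    cM g r k = 0 := by
  have h := cM_spec hk r
  simp only [AA_apply, not_le.mpr hr, if_false, hr.ne', ite_mul, one_mul, zero_mul,
    Finset.sum_ite_eq, Finset.mem_univ, if_true] at h
  exact h

lemma gcM {g : SL(n, ℝ)} {k : Fin n} (hk : (AA k g).det ≠ 0) {r : Fin n} (hr : r ≤ k) :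
    (g.1 * cM g) r k = if r = k then 1 else 0 := by
  rw [← cM_spec hk r, Matrix.mul_apply]
  simp only [AA_apply, hr, if_true]

lemma cM_det {g : SL(n, ℝ)} (h : ∀ k, (AA k g).det ≠ 0) : (cM g).det = 1 := by
  have h1 : (g.1 * cM g).det = 1 := by
    rw [Matrix.det_of_isLowerTriangular]
    · apply Finset.prod_eq_one
      intro k _
      rw [gcM (h k) le_rfl, if_pos rfl]
    · intro r s hrs
      have hrs : r < s := hrs
      rw [gcM (h s) hrs.le, if_neg hrs.ne]
  have h2 : g.1.det = 1 := g.2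
  rwa [Matrix.det_mul, h2, one_mul] at h1

open Classical in
/-- triangularising element -/
noncomputable def cS (g : SL(n, ℝ)) : SL(n, ℝ) :=
  if h : ∀ k, (AA k g).det ≠ 0 then ⟨cM g, cM_det h⟩ else 1

lemma cS_val {g : SL(n, ℝ)} (h : ∀ k, (AA k g).det ≠ 0) : (cS g).1 = cM g := by
  have e : cS g = ⟨cM g, cM_det h⟩ := dif_pos h
  exact congrArg Subtype.val e

lemma cS_UT (g : SL(n, ℝ)) : UT (cS g) := by
  intro r s hrs
  by_cases h : ∀ k, (AA k g).det ≠ 0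
  · rw [cS_val h, cM_upper (h s) hrs]
  · have e : cS g = 1 := dif_neg h
    rw [e]
    simp [hrs.ne']

lemma cS_ev {g : SL(n, ℝ)} (h : ∀ k, (AA k g).det ≠ 0) :
    ∀ᶠ x in 𝓝 g, ∀ k, (AA k x).det ≠ 0 := by
  rw [eventually_all]
  intro k
  exact ((AA_continuous k).matrix_det.continuousAt (x := g)).eventually_ne (h k)

lemma cS_cont {g : SL(n, ℝ)} (h : ∀ k, (AA k g).det ≠ 0) : Tendsto cS (𝓝 g) (𝓝 (cS g)) := by
  apply tendsto_SL
  intro r s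
  rw [cS_val h]
  have h1 : Tendsto (fun x => cM x r s) (𝓝 g) (𝓝 (cM g r s)) := by
    simp only [cM, Matrix.of_apply]
    refine Tendsto.div ?_ ?_ (h s)
    · have : Continuous fun x : SL(n, ℝ) => (AA s x).adjugate r s := by
        have := (AA_continuous (n := n) s).matrix_adjugate
        exact (continuous_apply_apply r s).comp this
      exact this.tendsto g
    · exact (AA_continuous s).matrix_det.tendsto g
  refine h1.congr' ?_
  filter_upwards [cS_ev h] with x hx
  rw [cS_val hx]

lemma ratio_lim {D : ℕ → Fin n → ℝ} (hpos : ∀ m k, 0 < D m k) {i j : Fin n} (hij : (i:ℕ) + 1 = j)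
    (h9 : ∀ k l : Fin n, (k:ℕ) + 1 = l → k ≠ i → Tendsto (fun m => D m l / D m k) atTop (𝓝 0))
    (h10 : Tendsto (fun m => D m i / D m j) atTop (𝓝 1)) :
    ∀ s r : Fin n, s < r → Tendsto (fun m => D m r / D m s) atTop
      (𝓝 (if s = i ∧ r = j then 1 else 0)) := by
  have hinv : Tendsto (fun m => D m j / D m i) atTop (𝓝 1) := by
    have := h10.inv₀ one_ne_zero
    rw [inv_one] at this
    refine this.congr fun m => ?_
    rw [inv_div]
  have hadj : ∀ s r : Fin n, (s:ℕ) + 1 = r → Tendsto (fun m => D m r / D m s) atTop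
      (𝓝 (if s = i ∧ r = j then 1 else 0)) := by
    intro s r hsr
    by_cases hs : s = i
    · subst hs
      have : r = j := Fin.ext (by omega)
      subst this
      simpa using hinv
    · simp only [hs, false_and, if_false]
      exact h9 s r hsr hs
  have main : ∀ (d : ℕ) (s r : Fin n), (s:ℕ) + (d + 1) = r → Tendsto (fun m => D m r / D m s) atTop
      (𝓝 (if s = i ∧ r = j then 1 else 0)) := by
    intro d
    induction d with
    | zero => intro s r h; exact hadj s r (by omega)
    | succ d ih =>
      intro s r h
      let t : Fin n := ⟨(s:ℕ) + (d+1), by omega⟩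
      have ht : (t:ℕ) = s + (d+1) := rfl
      have e1 := ih s t rfl
      have e2 := hadj t r (by omega)
      have e3 := e2.mul e1
      have hne : ¬ (s = i ∧ r = j) := by
        rintro ⟨rfl, rfl⟩; omega
      have hz : (if t = i ∧ r = j then (1:ℝ) else 0) * (if s = i ∧ t = j then 1 else 0) = 0 := by
        by_cases h1 : t = i
        · have : t ≠ j := by rw [h1]; exact ne_of_adj hij
          simp [this]
        · simp [h1]
      rw [hz] at e3
      rw [if_neg hne]
      refine e3.congr fun m => ?_
      have := (hpos m t).ne'
      have := (hpos m s).ne'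
      field_simp
  intro s r hsr
  have : (s:ℕ) < r := hsr
  exact main (r - s - 1) s r (by omega)

lemma dg_conj_apply (D : Fin n → ℝ) (hD : ∏ k, D k = 1) (hpos : ∀ k, 0 < D k) (u : SL(n, ℝ))
    (r s : Fin n) : (dg D hD * u * (dg D hD)⁻¹).1 r s = D r / D s * u.1 r s := by
  rw [dg_inv D hD hpos]
  show ((Matrix.diagonal D * u.1) * Matrix.diagonal (fun k => (D k)⁻¹)) r s = _
  rw [Matrix.mul_diagonal, Matrix.diagonal_mul]
  ring

lemma contraction {B : Subgroup (SL(n, ℝ))} (hB : ∀ g : SL(n, ℝ), g ∈ B ↔ UT g) {i j : Fin n}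
    (hij : (i:ℕ) + 1 = j) {γ L U : ℕ → SL(n, ℝ)} {D : ℕ → Fin n → ℝ} (hD : ∀ m, ∏ k, D m k = 1)
    (h2 : ∀ m k, 0 < D m k) (h3 : ∀ m, γ m = L m * dg (D m) (hD m) * U m)
    (h4 : Tendsto L atTop (𝓝 1)) (h5 : Tendsto U atTop (𝓝 1))
    (h9 : ∀ k l : Fin n, (k:ℕ) + 1 = l → k ≠ i → Tendsto (fun m => D m l / D m k) atTop (𝓝 0))
    (h10 : Tendsto (fun m => D m i / D m j) atTop (𝓝 1))
    (g : SL(n, ℝ)) (hg : ∀ k, (AA k g).det ≠ 0) :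
    Tendsto (fun m => (QuotientGroup.mk (γ m * g) : SL(n, ℝ) ⧸ B)) atTop
      (𝓝 (QuotientGroup.mk (blk (ne_of_adj hij) 1 0 ((g.1 * cM g) j i) 1 (by ring)))) := by
  have nij := ne_of_adj hij
  have hlim : Tendsto (fun m => U m * g) atTop (𝓝 g) := by
    have := h5.mul_const g
    rwa [one_mul] at this
  have hcl : Tendsto (fun m => cS (U m * g)) atTop (𝓝 (cS g)) := (cS_cont hg).comp hlim
  have hu : Tendsto (fun m => U m * g * cS (U m * g)) atTop (𝓝 (g * cS g)) := hlim.mul hcl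
  have hev := hlim.eventually (cS_ev hg)
  have hratio := ratio_lim h2 hij h9 h10
  have hconj : Tendsto (fun m => dg (D m) (hD m) * (U m * g * cS (U m * g)) * (dg (D m) (hD m))⁻¹)
      atTop (𝓝 (blk (ne_of_adj hij) 1 0 ((g.1 * cM g) j i) 1 (by ring))) := by
    apply tendsto_SL
    intro r s
    simp only [fun m => dg_conj_apply (D m) (hD m) (h2 m)]
    have hent : Tendsto (fun m => (U m * g * cS (U m * g)).1 r s) atTop (𝓝 ((g * cS g).1 r s)) :=
      ((continuous_entry r s).tendsto _).comp hu
    rw [Matrix.SpecialLinearGroup.coe_mul, cS_val hg] at hent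
    rcases lt_trichotomy r s with h | h | h
    · have hz : (blk (ne_of_adj hij) 1 0 ((g.1 * cM g) j i) 1 (by ring)).1 r s = 0 := by
        rw [blk_apply]
        have h' : (r:ℕ) < s := h
        split_ifs with a1 a2 a3 a4 a5 a6 a7
        · subst a1; subst a2; omega
        · rfl
        · rfl
        · subst a4; subst a5; omega
        · subst a4; subst a6; omega
        · rfl
        · subst a7; omega
        · rfl
      rw [hz]
      refine tendsto_const_nhds.congr' ?_
      filter_upwards [hev] with m hm
      rw [Matrix.SpecialLinearGroup.coe_mul, cS_val hm, gcM (hm s) h.le, if_neg h.ne, mul_zero]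
    · subst h
      have hz : (blk (ne_of_adj hij) 1 0 ((g.1 * cM g) j i) 1 (by ring)).1 r r = 1 := by
        rw [blk_apply]
        by_cases h1 : r = i <;> by_cases h2 : r = j <;> simp_all
      rw [hz]
      refine tendsto_const_nhds.congr' ?_
      filter_upwards [hev] with m hm
      rw [Matrix.SpecialLinearGroup.coe_mul, cS_val hm, gcM (hm r) le_rfl, if_pos rfl, mul_one,
        div_self (h2 m r).ne']
    · have hz : (blk (ne_of_adj hij) 1 0 ((g.1 * cM g) j i) 1 (by ring)).1 r s =
          (if s = i ∧ r = j then 1 else 0) * (g.1 * cM g) r s := by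
        rw [blk_apply]
        have h' : (s:ℕ) < r := h
        by_cases h1 : r = i
        · subst h1
          have e1 : s ≠ r := h.ne
          have e2 : s ≠ j := by rintro rfl; omega
          simp [e1, e2, nij]
        · by_cases h2 : r = j
          · subst h2
            by_cases h3 : s = i
            · subst h3; simp [h1]
            · have e1 : s ≠ r := h.ne
              simp [h1, h3, e1]
          · simp [h1, h2, h.ne']
      rw [hz]
      exact (hratio s r h).mul hent
  have htot := h4.mul hconj
  rw [one_mul] at htot
  have hq : Tendsto (fun m => (QuotientGroup.mk (L m * (dg (D m) (hD m) * (U m * g * cS (U m * g)) *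
      (dg (D m) (hD m))⁻¹)) : SL(n, ℝ) ⧸ B)) atTop
      (𝓝 (QuotientGroup.mk (blk (ne_of_adj hij) 1 0 ((g.1 * cM g) j i) 1 (by ring)))) :=
    (QuotientGroup.continuous_mk.tendsto _).comp htot
  refine hq.congr fun m => ?_
  rw [QuotientGroup.eq, h3]
  have hdgB : dg (D m) (hD m) ∈ B := (hB _).mpr (by
    intro r t hrt
    rw [dg_apply, if_neg hrt.ne'])
  have hcB : cS (U m * g) ∈ B := (hB _).mpr (cS_UT _)
  have := mul_mem hdgB (inv_mem hcB)
  convert this using 1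
  group


/-- normalised matrix -/
noncomputable def MM (i : Fin n) (y : SL(n, ℝ)) : Matrix (Fin n) (Fin n) ℝ := y.1 * (AA i y)⁻¹

/-- numerator -/
noncomputable def NN (i j : Fin n) (y : SL(n, ℝ)) : ℝ := ∑ s, y.1 j s * (AA i y).adjugate s i

lemma inv_entry (i : Fin n) (y : SL(n, ℝ)) (s t : Fin n) :
    (AA i y)⁻¹ s t = (AA i y).adjugate s t / (AA i y).det := by
  rw [Matrix.inv_def, Matrix.smul_apply, Ring.inverse_eq_inv', smul_eq_mul]
  ring

lemma MM_eq_cM (i j : Fin n) (y : SL(n, ℝ)) : (y.1 * cM y) j i = MM i y j i := by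
  rw [MM, Matrix.mul_apply, Matrix.mul_apply]
  refine Finset.sum_congr rfl fun s _ => ?_
  rw [inv_entry]
  rfl

lemma MM_eq_NN (i j : Fin n) (y : SL(n, ℝ)) : MM i y j i = NN i j y / (AA i y).det := by
  rw [MM, Matrix.mul_apply, NN, Finset.sum_div]
  refine Finset.sum_congr rfl fun s _ => ?_
  rw [inv_entry, mul_div_assoc]

lemma MM_row {i : Fin n} {y : SL(n, ℝ)} (hy : (AA i y).det ≠ 0) {r : Fin n} (hr : r ≤ i)
    (s : Fin n) : MM i y r s = if r = s then 1 else 0 := by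
  have h := congrFun (congrFun (Matrix.mul_nonsing_inv (AA i y) (isUnit_iff_ne_zero.mpr hy)) r) s
  rw [Matrix.one_apply, Matrix.mul_apply] at h
  rw [← h, MM, Matrix.mul_apply]
  refine Finset.sum_congr rfl fun t _ => ?_
  rw [AA_apply, if_pos hr]

lemma AAinv_low {i : Fin n} {y : SL(n, ℝ)} (hy : (AA i y).det ≠ 0) {a b : Fin n} (ha : i < a)
    (hb : b ≤ i) : (AA i y)⁻¹ a b = 0 := by
  have h := congrFun (congrFun (Matrix.mul_nonsing_inv (AA i y) (isUnit_iff_ne_zero.mpr hy)) a) b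
  rw [Matrix.one_apply, Matrix.mul_apply, if_neg (lt_of_le_of_lt hb ha).ne'] at h
  simp only [AA_apply, not_le.mpr ha, if_false, ite_mul, one_mul, zero_mul,
    Finset.sum_ite_eq, Finset.mem_univ, if_true] at h
  exact h

lemma sep {i : Fin n} {y p : SL(n, ℝ)} (hy : (AA i y).det ≠ 0) (hy' : (AA i (y * p)).det ≠ 0)
    (h : ∀ a b, i < a → b ≤ i → MM i y a b = MM i (y * p) a b) {a b : Fin n} (ha : i < a)
    (hb : b ≤ i) : p.1 a b = 0 := by
  have hcol : ∀ r b, b ≤ i → MM i y r b = MM i (y * p) r b := by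
    intro r b hb
    by_cases hr : r ≤ i
    · rw [MM_row hy hr, MM_row hy' hr]
    · exact h r b (not_le.mp hr) hb
  have hyu : IsUnit y.1.det := by
    have : y.1.det = 1 := y.2
    rw [this]; exact isUnit_one
  have hinv : ∀ r b, b ≤ i → (AA i y)⁻¹ r b = (p.1 * (AA i (y * p))⁻¹) r b := by
    intro r b hb
    have e1 : (AA i y)⁻¹ = y.1⁻¹ * MM i y := by
      rw [MM, Matrix.nonsing_inv_mul_cancel_left _ _ hyu]
    have e2 : p.1 * (AA i (y * p))⁻¹ = y.1⁻¹ * MM i (y * p) := by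
      rw [MM, Matrix.SpecialLinearGroup.coe_mul, Matrix.mul_assoc,
        Matrix.nonsing_inv_mul_cancel_left _ _ hyu]
    rw [e1, e2, Matrix.mul_apply, Matrix.mul_apply]
    exact Finset.sum_congr rfl fun t _ => by rw [hcol t b hb]
  have e3 : p.1 = (p.1 * (AA i (y * p))⁻¹) * AA i (y * p) := by
    rw [Matrix.mul_assoc, Matrix.nonsing_inv_mul _ (isUnit_iff_ne_zero.mpr hy'), Matrix.mul_one]
  rw [e3, Matrix.mul_apply]
  refine Finset.sum_eq_zero fun k _ => ?_
  by_cases hk : k ≤ i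
  · rw [← hinv a k hk, AAinv_low hy ha hk, zero_mul]
  · have : k ≠ b := by rintro rfl; exact hk hb
    rw [AA_apply, if_neg hk, if_neg this, mul_zero]

lemma moveII {i j a : Fin n} (hj : i < j) (ha : i < a) (hja : j ≠ a) (y : SL(n, ℝ)) :
    AA i (el hja 1 * y) = AA i y ∧ ∀ b, MM i (el hja 1 * y) j b = MM i y j b + MM i y a b := by
  have h1 : AA i (el hja 1 * y) = AA i y := by
    ext r s
    rw [AA_apply, AA_apply]
    split_ifs with h
    · have e1 : r ≠ j := by rintro rfl; exact absurd hj (not_lt.mpr h)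
      have e2 : r ≠ a := by rintro rfl; exact absurd ha (not_lt.mpr h)
      rw [el, blk_mul_apply, if_neg e1, if_neg e2]
    · rfl
    · rfl
  refine ⟨h1, fun b => ?_⟩
  rw [MM, h1, MM, Matrix.mul_apply, Matrix.mul_apply, Matrix.mul_apply, ← Finset.sum_add_distrib]
  refine Finset.sum_congr rfl fun s _ => ?_
  rw [el, blk_mul_apply, if_pos rfl]
  ring

lemma moveI {i j b : Fin n} (hj : i < j) (hb : b ≤ i) (hbi : b ≠ i) (y : SL(n, ℝ)) :
    (AA i (el hbi (-1) * y)).det = (AA i y).det ∧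
    MM i (el hbi (-1) * y) j i = MM i y j i + MM i y j b := by
  have h1 : AA i (el hbi (-1) * y) = (el hbi (-1)).1 * AA i y := by
    ext r s
    have e := blkM_mul_apply hbi 1 (-1) 0 1 (AA i y) r s
    refine Eq.trans ?_ e.symm
    rw [AA_apply, el, blk_mul_apply]
    simp only [AA_apply, hb, le_refl, if_true]
    by_cases h2 : r = b
    · subst h2; simp [hb]
    · by_cases h3 : r = i
      · subst h3; simp [h2]
      · simp [h2, h3]
  have hd : (el hbi (-1)).1.det = 1 := (el hbi (-1)).2
  have h2 : (el hbi (-1)).1⁻¹ = (el hbi 1).1 := by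
    apply Matrix.inv_eq_left_inv
    have : el hbi 1 * el hbi (-1) = 1 := by
      rw [el, el, blk_mul, ← blk_one hbi]
      apply blk_congr <;> ring
    exact congrArg Subtype.val this
  refine ⟨by rw [h1, Matrix.det_mul, hd, one_mul], ?_⟩
  have h3 : MM i (el hbi (-1) * y) = (el hbi (-1)).1 * (MM i y * (el hbi 1).1) := by
    rw [MM, h1, Matrix.mul_inv_rev, h2, MM, Matrix.SpecialLinearGroup.coe_mul]
    simp only [Matrix.mul_assoc]
  have e1 : j ≠ b := (lt_of_le_of_lt hb hj).ne'
  have e2 : j ≠ i := hj.ne'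
  have e := blkM_mul_apply hbi 1 (-1) 0 1 (MM i y * (el hbi 1).1) j i
  rw [if_neg e1, if_neg e2] at e
  rw [h3]
  refine e.trans ?_
  rw [Matrix.mul_apply]
  have : ∀ k, MM i y j k * (el hbi 1).1 k i = (if k = i then MM i y j k else 0) +
      (if k = b then MM i y j k else 0) := by
    intro k
    rw [el, blk_apply]
    by_cases h2 : k = b
    · subst h2; simp [hbi, hbi.symm]
    · by_cases h3 : k = i
      · subst h3; simp [h2, hbi.symm]
      · simp [h2, h3]
  simp only [this, Finset.sum_add_distrib, Finset.sum_ite_eq', Finset.mem_univ, if_true]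

lemma AA_one (k : Fin n) : AA k (1 : SL(n, ℝ)) = 1 := by
  ext r s
  rw [AA_apply, Matrix.one_apply, Matrix.SpecialLinearGroup.coe_one, Matrix.one_apply]
  split_ifs <;> rfl

lemma Pol_AA (k r s : Fin n) : Pol (fun x : SL(n, ℝ) => AA k x r s) := by
  simp only [AA_apply]
  split_ifs
  · exact Pol.entry r s
  · exact Pol.const _
  · exact Pol.const _

lemma Pol_D (k : Fin n) : Pol (fun x : SL(n, ℝ) => (AA k x).det) := Pol.det (Pol_AA k)

lemma Pol_N (i j : Fin n) : Pol (fun x : SL(n, ℝ) => NN i j x) := by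
  unfold NN
  exact Pol.sum _ fun s => (Pol.entry j s).mul (Pol.adj (Pol_AA i) s i)

lemma D_ne (k : Fin n) (g : SL(n, ℝ)) : ∃ x, (AA k (x * g)).det ≠ 0 :=
  ⟨g⁻¹, by rw [inv_mul_cancel, AA_one, Matrix.det_one]; exact one_ne_zero⟩

lemma witness (hn : 3 ≤ n) {i j : Fin n} (hij : (i:ℕ) + 1 = j) {g p : SL(n, ℝ)} {a b : Fin n}
    (ha : i < a) (hb : b ≤ i) (hp : p.1 a b ≠ 0) :
    ∃ x, (AA i (x * g)).det ≠ 0 ∧ (AA i (x * (g * p))).det ≠ 0 ∧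
      MM i (x * g) j i ≠ MM i (x * (g * p)) j i := by
  have hj : i < j := by rw [Fin.lt_def]; omega
  have key : ∃ x, ((AA i (x * g)).det ≠ 0 ∧ (AA i (x * (g * p))).det ≠ 0) ∧
      ∃ a b, i < a ∧ b ≤ i ∧ MM i (x * g) a b ≠ MM i (x * (g * p)) a b := by
    have h0 := gen_mul hn (Pol.const 1) ((Pol_D i).right g) ⟨1, one_mem _, one_ne_zero⟩ (D_ne i g)
    obtain ⟨γ, hγ, h0⟩ := h0
    obtain ⟨x, -, h1, h2⟩ := gen_two hn ((Pol_D i).right g) ((Pol_D i).right (g * p))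
      ⟨γ, hγ, (mul_ne_zero_iff.mp h0).2⟩ (D_ne i (g * p))
    refine ⟨x, ⟨h1, h2⟩, ?_⟩
    by_contra hcon
    push Not at hcon
    apply hp
    have h2' : (AA i (x * g * p)).det ≠ 0 := by rw [mul_assoc]; exact h2
    refine sep h1 h2' ?_ ha hb
    intro a b ha hb
    rw [mul_assoc]
    exact hcon a b ha hb
  obtain ⟨x, ⟨h1, h2⟩, a, b, ha, hb, hne⟩ := key
  have key2 : ∃ x, ((AA i (x * g)).det ≠ 0 ∧ (AA i (x * (g * p))).det ≠ 0) ∧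
      ∃ b, b ≤ i ∧ MM i (x * g) j b ≠ MM i (x * (g * p)) j b := by
    by_cases hja : j = a
    · subst hja; exact ⟨x, ⟨h1, h2⟩, b, hb, hne⟩
    by_cases hjb : MM i (x * g) j b = MM i (x * (g * p)) j b
    · obtain ⟨e1, e2⟩ := moveII hj ha hja (x * g)
      obtain ⟨e3, e4⟩ := moveII hj ha hja (x * (g * p))
      rw [← mul_assoc] at e1 e2 e3 e4
      refine ⟨el hja 1 * x, ⟨by rwa [e1], by rwa [e3]⟩, b, hb, ?_⟩
      rw [e2, e4, hjb]
      intro h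
      exact hne (add_left_cancel h)
    · exact ⟨x, ⟨h1, h2⟩, b, hb, hjb⟩
  clear hne ha hb h1 h2
  obtain ⟨x, ⟨h1, h2⟩, b, hb, hne⟩ := key2
  by_cases hbi : b = i
  · subst hbi; exact ⟨x, h1, h2, hne⟩
  by_cases hji : MM i (x * g) j i = MM i (x * (g * p)) j i
  · obtain ⟨e1, e2⟩ := moveI hj hb hbi (x * g)
    obtain ⟨e3, e4⟩ := moveI hj hb hbi (x * (g * p))
    rw [← mul_assoc] at e1 e2 e3 e4
    refine ⟨el hbi (-1) * x, by rwa [e1], by rwa [e3], ?_⟩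
    rw [e2, e4, hji]
    intro h
    exact hne (add_left_cancel h)
  · exact ⟨x, h1, h2, hji⟩

lemma generic (hn : 3 ≤ n) {i j : Fin n} (hij : (i:ℕ) + 1 = j) {g p : SL(n, ℝ)} {a b : Fin n}
    (ha : i < a) (hb : b ≤ i) (hp : p.1 a b ≠ 0) :
    ∃ γ ∈ SLZ n, (∀ k, (AA k (γ * g)).det ≠ 0) ∧ (∀ k, (AA k (γ * (g * p))).det ≠ 0) ∧
      ((γ * g).1 * cM (γ * g)) j i ≠ ((γ * (g * p)).1 * cM (γ * (g * p))) j i := by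
  have hf1 : ∀ k, Pol (fun x : SL(n, ℝ) => (AA k (x * g)).det) := fun k => (Pol_D k).right g
  have hf2 : ∀ k, Pol (fun x : SL(n, ℝ) => (AA k (x * (g * p))).det) :=
    fun k => (Pol_D k).right (g * p)
  obtain ⟨γ1, hγ1, hγ1'⟩ := gen_prod hn Finset.univ (fun k => (hf1 k).mul (hf2 k)) (by
    intro k
    obtain ⟨γ, hγ, h0⟩ := gen_mul hn (Pol.const 1) (hf1 k) ⟨1, one_mem _, one_ne_zero⟩ (D_ne k g)
    obtain ⟨x, -, h1⟩ := gen_mul hn (hf1 k) (hf2 k)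
      ⟨γ, hγ, (mul_ne_zero_iff.mp h0).2⟩ (D_ne k (g * p))
    exact ⟨x, h1⟩)
  have hw : Pol (fun x : SL(n, ℝ) => NN i j (x * g) * (AA i (x * (g * p))).det -
      NN i j (x * (g * p)) * (AA i (x * g)).det) :=
    (((Pol_N i j).right g).mul (hf2 i)).sub (((Pol_N i j).right (g * p)).mul (hf1 i))
  have hiff : ∀ x : SL(n, ℝ), (AA i (x * g)).det ≠ 0 → (AA i (x * (g * p))).det ≠ 0 →
      (MM i (x * g) j i ≠ MM i (x * (g * p)) j i ↔ NN i j (x * g) * (AA i (x * (g * p))).det -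
      NN i j (x * (g * p)) * (AA i (x * g)).det ≠ 0) := by
    intro x h1 h2
    rw [MM_eq_NN, MM_eq_NN, Ne, div_eq_div_iff h1 h2, sub_ne_zero]
  obtain ⟨x, hx1, hx2, hx3⟩ := witness hn hij (g := g) ha hb hp
  obtain ⟨γ, hγ, h1, h2⟩ := gen_two hn (Pol.prod Finset.univ (fun k => (hf1 k).mul (hf2 k))) hw
    ⟨γ1, hγ1, hγ1'⟩ ⟨x, (hiff x hx1 hx2).mp hx3⟩
  have h1' : ∀ k, (AA k (γ * g)).det * (AA k (γ * (g * p))).det ≠ 0 := fun k =>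
    Finset.prod_ne_zero_iff.mp h1 k (Finset.mem_univ k)
  have ha1 : ∀ k, (AA k (γ * g)).det ≠ 0 := fun k => (mul_ne_zero_iff.mp (h1' k)).1
  have ha2 : ∀ k, (AA k (γ * (g * p))).det ≠ 0 := fun k => (mul_ne_zero_iff.mp (h1' k)).2
  refine ⟨γ, hγ, ha1, ha2, ?_⟩
  rw [MM_eq_cM, MM_eq_cM]
  exact (hiff γ (ha1 i) (ha2 i)).mpr h2

lemma step1 (hn : 3 ≤ n) {B : Subgroup (SL(n, ℝ))} (hB : ∀ g : SL(n, ℝ), g ∈ B ↔ UT g)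
    {X : Type} [TopologicalSpace X] [T2Space X] [MulAction (SLZ n) X]
    (φ : SL(n, ℝ) ⧸ B → X) (hφ : Continuous φ)
    (heq : ∀ (γ : SLZ n) (x : SL(n, ℝ) ⧸ B), φ ((γ : SL(n, ℝ)) • x) = γ • φ x)
    {i j : Fin n} (hij : (i:ℕ) + 1 = j) {g p : SL(n, ℝ)} {a b : Fin n}
    (ha : i < a) (hb : b ≤ i) (hp : p.1 a b ≠ 0)
    (hgp : φ (QuotientGroup.mk g) = φ (QuotientGroup.mk (g * p))) :
    ∃ c c' : ℝ, c ≠ c' ∧ φ (QuotientGroup.mk (blk (ne_of_adj hij) 1 0 c 1 (by ring))) =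
      φ (QuotientGroup.mk (blk (ne_of_adj hij) 1 0 c' 1 (by ring))) := by
  obtain ⟨γ0, hγ0, h1, h2, h3⟩ := generic hn hij (g := g) ha hb hp
  obtain ⟨γ, L, U, D, hD, e1, e2, e3, e4, e5, -, -, -, e9, e10⟩ := good_all hn i j hij 1 one_pos
  have c1 := contraction hB hij hD e2 e3 e4 e5 e9 e10 (γ0 * g) h1
  have c2 := contraction hB hij hD e2 e3 e4 e5 e9 e10 (γ0 * (g * p)) h2
  have d1 := (hφ.tendsto _).comp c1
  have d2 := (hφ.tendsto _).comp c2
  refine ⟨_, _, h3, tendsto_nhds_unique d1 (d2.congr fun m => ?_)⟩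
  have e := heq ⟨γ m * γ0, mul_mem (e1 m) hγ0⟩
  have f1 := e (QuotientGroup.mk g)
  have f2 := e (QuotientGroup.mk (g * p))
  rw [← hgp, ← f1] at f2
  show φ (QuotientGroup.mk (γ m * (γ0 * (g * p)))) = φ (QuotientGroup.mk (γ m * (γ0 * g)))
  rw [← mul_assoc, ← mul_assoc (γ m) γ0 g]
  exact f2

lemma mul_low_apply {i j : Fin n} (hij : i ≠ j) (c : ℝ) (h : SL(n, ℝ)) (r s : Fin n) :
    (h * blk hij 1 0 c 1 (by ring)).1 r s = if s = i then h.1 r i + c * h.1 r j else h.1 r s := by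
  rw [Matrix.SpecialLinearGroup.coe_mul, Matrix.mul_apply]
  have : ∀ k, h.1 r k * (blk hij 1 0 c 1 (by ring)).1 k s = (if k = s then h.1 r k else 0) +
      (if k = j then (if s = i then c * h.1 r k else 0) else 0) := by
    intro k
    rw [blk_apply]
    by_cases h2 : k = i
    · subst h2
      by_cases h3 : s = k
      · subst h3; simp [hij]
      · simp [hij, h3, Ne.symm h3]
    · by_cases h3 : k = j
      · subst h3
        by_cases h4 : s = i
        · subst h4; simp [h2]; ring
        · by_cases h5 : s = k
          · subst h5; simp [h2]
          · simp [h2, h4, h5, Ne.symm h5]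
      · simp [h2, h3]
  simp only [this, Finset.sum_add_distrib, Finset.sum_ite_eq', Finset.mem_univ, if_true]
  split_ifs with h1
  · subst h1; ring
  · ring

lemma low_conj {B : Subgroup (SL(n, ℝ))} (hB : ∀ g : SL(n, ℝ), g ∈ B ↔ UT g) {i j : Fin n}
    (hij : (i:ℕ) + 1 = j) (c : ℝ) {h : SL(n, ℝ)} (hh : h ∈ HH B hB hij) :
    blk (ne_of_adj hij) 1 0 (-c) 1 (by ring) * (h * blk (ne_of_adj hij) 1 0 c 1 (by ring)) ∈ B := by
  obtain ⟨h1, h2, h3⟩ := hh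
  have hu := (hB h).mp h1
  have nij := ne_of_adj hij
  rw [hB]
  intro r s hrs
  have hrs' : (s:ℕ) < r := hrs
  rw [blk_mul_apply]
  simp only [mul_low_apply]
  by_cases hr : r = j
  · subst hr
    rw [if_neg nij.symm, if_pos rfl]
    by_cases hs : s = i
    · subst hs
      rw [if_pos rfl, if_pos rfl, hu r s hrs, h2, h3]; ring
    · rw [if_neg hs, if_neg hs, hu r s hrs, hu i s]
      · ring
      · have : (s:ℕ) ≠ i := fun h => hs (Fin.ext h)
        rw [Fin.lt_def]; omega
  · have hr' : (r:ℕ) ≠ j := fun h => hr (Fin.ext h)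
    rw [if_neg hr]
    by_cases hs : s = i
    · subst hs
      rw [if_pos rfl, if_pos rfl, if_neg hrs.ne', hu r s hrs, hu r j]
      · simp
      · rw [Fin.lt_def]; omega
    · simp only [if_neg hs, hu r s hrs]
      by_cases hri : r = i
      · subst hri
        rw [if_pos rfl, hu r s hrs, hu j s]
        · ring
        · rw [Fin.lt_def]; omega
      · rw [if_neg hri]

/-- stabiliser of the fibres -/
def PP {B : Subgroup (SL(n, ℝ))} {X : Type} (φ : SL(n, ℝ) ⧸ B → X) : Subgroup (SL(n, ℝ)) where
  carrier := {p | ∀ κ : SL(n, ℝ), φ (QuotientGroup.mk (κ * p)) = φ (QuotientGroup.mk κ)}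
  one_mem' := by intro κ; rw [mul_one]
  mul_mem' := by
    intro a b ha hb κ
    rw [← mul_assoc, hb, ha]
  inv_mem' := by
    intro a ha κ
    have := ha (κ * a⁻¹)
    rw [inv_mul_cancel_right] at this
    exact this.symm

lemma mem_PP {B : Subgroup (SL(n, ℝ))} {X : Type} (φ : SL(n, ℝ) ⧸ B → X) (p : SL(n, ℝ)) :
    p ∈ PP φ ↔ ∀ κ : SL(n, ℝ), φ (QuotientGroup.mk (κ * p)) = φ (QuotientGroup.mk κ) := Iff.rfl

lemma B_le_PP {B : Subgroup (SL(n, ℝ))} {X : Type} (φ : SL(n, ℝ) ⧸ B → X) : B ≤ PP φ := by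
  intro b hb κ
  congr 1
  rw [QuotientGroup.eq]
  rw [_root_.mul_inv_rev, mul_assoc, inv_mul_cancel, mul_one]
  exact inv_mem hb

lemma isClosed_PP {B : Subgroup (SL(n, ℝ))} {X : Type} [TopologicalSpace X] [T2Space X]
    {φ : SL(n, ℝ) ⧸ B → X} (hφ : Continuous φ) : IsClosed (PP φ : Set (SL(n, ℝ))) := by
  have : (PP φ : Set (SL(n, ℝ))) =
      ⋂ κ : SL(n, ℝ), {p | φ (QuotientGroup.mk (κ * p)) = φ (QuotientGroup.mk κ)} := by
    ext p
    rw [Set.mem_iInter]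
    rfl
  rw [this]
  refine isClosed_iInter fun κ => isClosed_eq ?_ continuous_const
  exact hφ.comp (QuotientGroup.continuous_mk.comp (continuous_const.mul continuous_id))

lemma step2 (hn : 3 ≤ n) {B : Subgroup (SL(n, ℝ))} (hB : ∀ g : SL(n, ℝ), g ∈ B ↔ UT g)
    {X : Type} [TopologicalSpace X] [T2Space X] [MulAction (SLZ n) X]
    (φ : SL(n, ℝ) ⧸ B → X) (hφ : Continuous φ)
    (heq : ∀ (γ : SLZ n) (x : SL(n, ℝ) ⧸ B), φ ((γ : SL(n, ℝ)) • x) = γ • φ x)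
    {i j : Fin n} (hij : (i:ℕ) + 1 = j) {c c' : ℝ}
    (hc : φ (QuotientGroup.mk (blk (ne_of_adj hij) 1 0 c 1 (by ring))) =
      φ (QuotientGroup.mk (blk (ne_of_adj hij) 1 0 c' 1 (by ring)))) :
    blk (ne_of_adj hij) 1 0 (c' - c) 1 (by ring) ∈ PP φ := by
  have hall := dense_H hB hij (good_all hn i j hij)
    {κ : SL(n, ℝ) | φ (QuotientGroup.mk (κ * blk (ne_of_adj hij) 1 0 c 1 (by ring))) =
      φ (QuotientGroup.mk (κ * blk (ne_of_adj hij) 1 0 c' 1 (by ring)))}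
    (isClosed_eq
      (hφ.comp (QuotientGroup.continuous_mk.comp (continuous_id.mul continuous_const)))
      (hφ.comp (QuotientGroup.continuous_mk.comp (continuous_id.mul continuous_const))))
    (by
      intro γ hγ x hx
      show φ (QuotientGroup.mk (γ * x * _)) = φ (QuotientGroup.mk (γ * x * _))
      have hx : φ (QuotientGroup.mk (x * _)) = φ (QuotientGroup.mk (x * _)) := hx
      rw [mul_assoc, mul_assoc]
      have e1 := heq ⟨γ, hγ⟩ (QuotientGroup.mk (x * blk (ne_of_adj hij) 1 0 c 1 (by ring)))
      have e2 := heq ⟨γ, hγ⟩ (QuotientGroup.mk (x * blk (ne_of_adj hij) 1 0 c' 1 (by ring)))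
      rw [hx, ← e2] at e1
      exact e1)
    (by
      intro h hh x hx
      have key : ∀ c : ℝ, (QuotientGroup.mk (x * h * blk (ne_of_adj hij) 1 0 c 1 (by ring)) :
          SL(n, ℝ) ⧸ B) = QuotientGroup.mk (x * blk (ne_of_adj hij) 1 0 c 1 (by ring)) := by
        intro c
        symm
        rw [QuotientGroup.eq]
        have := low_conj hB hij c hh
        have hinv : (blk (ne_of_adj hij) 1 0 c 1 (by ring))⁻¹ =
            blk (ne_of_adj hij) 1 0 (-c) 1 (by ring) := by
          rw [inv_eq_iff_mul_eq_one, blk_mul, ← blk_one (ne_of_adj hij)]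
          apply blk_congr <;> ring
        rw [← hinv] at this
        convert this using 1
        group
      show φ _ = φ _
      rw [key, key]
      exact hx)
    (by
      show φ _ = φ _
      have e : ∀ x : SL(n, ℝ), 1 * x = x := one_mul
      rw [e, e]; exact hc)
  rw [mem_PP]
  intro κ
  have h := hall (κ * blk (ne_of_adj hij) 1 0 (-c) 1 (by ring))
  have h : φ (QuotientGroup.mk (κ * blk (ne_of_adj hij) 1 0 (-c) 1 (by ring) *
      blk (ne_of_adj hij) 1 0 c 1 (by ring))) = φ (QuotientGroup.mk
      (κ * blk (ne_of_adj hij) 1 0 (-c) 1 (by ring) *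
      blk (ne_of_adj hij) 1 0 c' 1 (by ring))) := h
  rw [mul_assoc, mul_assoc, blk_mul, blk_mul] at h
  have e1 : blk (ne_of_adj hij) (1 * 1 + 0 * c) (1 * 0 + 0 * 1) (-c * 1 + 1 * c) (-c * 0 + 1 * 1)
      (by ring) = 1 := by
    rw [← blk_one (ne_of_adj hij)]
    apply blk_congr <;> ring
  have e2 : blk (ne_of_adj hij) (1 * 1 + 0 * c') (1 * 0 + 0 * 1) (-c * 1 + 1 * c') (-c * 0 + 1 * 1)
      (by ring) = blk (ne_of_adj hij) 1 0 (c' - c) 1 (by ring) := by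
    apply blk_congr <;> ring
  rw [e1, e2, mul_one] at h
  exact h.symm

lemma rot_mem {B : Subgroup (SL(n, ℝ))} (hB : ∀ g : SL(n, ℝ), g ∈ B ↔ UT g)
    (Q : Subgroup (SL(n, ℝ))) (hBQ : B ≤ Q) {i j : Fin n} (hij : (i:ℕ) + 1 = j) {t : ℝ}
    (ht : t ≠ 0) (h : blk (ne_of_adj hij) 1 0 t 1 (by ring) ∈ Q) (a b : ℝ)
    (hab : a * a - b * (-b) = 1) : blk (ne_of_adj hij) a b (-b) a hab ∈ Q := by
  have hup : ∀ a b d h, blk (ne_of_adj hij) a b 0 d h ∈ Q := fun a b d h =>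
    hBQ ((hB _).mpr (blk_ut hij a b d h))
  have hlow1 : ∀ s : ℝ, 0 < s → blk (ne_of_adj hij) 1 0 (s * t) 1 (by ring) ∈ Q := by
    intro s hs
    have hq : Real.sqrt s ≠ 0 := (Real.sqrt_pos.mpr hs).ne'
    have hqq : Real.sqrt s * Real.sqrt s = s := Real.mul_self_sqrt hs.le
    have := mul_mem (mul_mem (hup (Real.sqrt s)⁻¹ 0 (Real.sqrt s) (by field_simp; ring)) h)
      (hup (Real.sqrt s) 0 (Real.sqrt s)⁻¹ (by field_simp; ring))
    rw [blk_mul, blk_mul] at this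
    convert this using 1
    apply blk_congr
    · field_simp; ring
    · ring
    · linear_combination (-t) * hqq
    · field_simp; ring
  have hlow : ∀ s : ℝ, blk (ne_of_adj hij) 1 0 s 1 (by ring) ∈ Q := by
    intro s
    rcases lt_trichotomy (s / t) 0 with h0 | h0 | h0
    · have := inv_mem (hlow1 (-(s / t)) (by linarith))
      have e : (blk (ne_of_adj hij) 1 0 (-(s / t) * t) 1 (by ring))⁻¹ =
          blk (ne_of_adj hij) 1 0 s 1 (by ring) := by
        rw [inv_eq_iff_mul_eq_one, blk_mul, ← blk_one (ne_of_adj hij)]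
        apply blk_congr <;> field_simp <;> ring
      rwa [e] at this
    · have : s = 0 := by
        rcases div_eq_zero_iff.mp h0 with h1 | h1
        · exact h1
        · exact absurd h1 ht
      subst this
      rw [blk_one]
      exact one_mem _
    · have := hlow1 (s / t) h0
      convert this using 1
      apply blk_congr
      · rfl
      · rfl
      · field_simp
      · rfl
  have hgen : ∀ a b c d h, a ≠ 0 → blk (ne_of_adj hij) a b c d h ∈ Q := by
    intro a b c d h ha
    have := mul_mem (hlow (c / a)) (hup a b a⁻¹ (by field_simp; ring))
    rw [blk_mul] at this
    convert this using 1
    apply blk_congr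
    · ring
    · ring
    · field_simp; ring
    · field_simp; linarith
  by_cases ha : a = 0
  · subst ha
    have hb : b ≠ 0 := by rintro rfl; simp at hab
    have h1 := hgen (-b) b (-b) 0 (by linarith) (neg_ne_zero.mpr hb)
    have h2 := mul_mem (inv_mem (hup 1 1 1 (by ring))) h1
    have e : blk (ne_of_adj hij) 0 b (-b) 0 hab =
        (blk (ne_of_adj hij) 1 1 0 1 (by ring))⁻¹ * blk (ne_of_adj hij) (-b) b (-b) 0 (by linarith) := by
      rw [eq_inv_mul_iff_mul_eq, blk_mul]
      apply blk_congr <;> ring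
    rw [e]
    exact h2
  · exact hgen _ _ _ _ _ ha

lemma mem_PP_of (hn : 3 ≤ n) {B : Subgroup (SL(n, ℝ))} (hB : ∀ g : SL(n, ℝ), g ∈ B ↔ UT g)
    {X : Type} [TopologicalSpace X] [T2Space X] [MulAction (SLZ n) X]
    (φ : SL(n, ℝ) ⧸ B → X) (hφ : Continuous φ)
    (heq : ∀ (γ : SLZ n) (x : SL(n, ℝ) ⧸ B), φ ((γ : SL(n, ℝ)) • x) = γ • φ x)
    {g p : SL(n, ℝ)} (hgp : φ (QuotientGroup.mk g) = φ (QuotientGroup.mk (g * p))) :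
    p ∈ PP φ := by
  obtain ⟨q, hq, hqp⟩ := givens (PP φ)
    {i : Fin n | ∀ (j : Fin n) (h : (i:ℕ) + 1 = j), ∀ (a b : ℝ) (hab : a * a - b * (-b) = 1),
      blk (ne_of_adj h) a b (-b) a hab ∈ PP φ}
    (fun i j h hi => hi j h) p (by
      intro i hi r s hs hr
      by_contra hne
      apply hi
      intro j hij
      obtain ⟨c, c', hcc, hc⟩ := step1 hn hB φ hφ heq hij hr hs hne hgp
      exact rot_mem hB _ (B_le_PP φ) hij (sub_ne_zero.mpr hcc.symm) (step2 hn hB φ hφ heq hij hc))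
  have h1 : q * p ∈ PP φ := B_le_PP φ ((hB _).mpr hqp)
  have := mul_mem (inv_mem hq) h1
  rwa [inv_mul_cancel_left] at this

end Dani

theorem dani_equivariant_images (n : ℕ) (hn : 3 ≤ n)
    (B : Subgroup (SL(n, ℝ)))
    (hB : ∀ g : SL(n, ℝ), g ∈ B ↔
      ∀ i j : Fin n, j < i → (g : Matrix (Fin n) (Fin n) ℝ) i j = 0)
    (X : Type) [TopologicalSpace X] [CompactSpace X] [T2Space X]
    [MulAction (SLZ n) X]
    (hact : ∀ γ : SLZ n, Continuous fun x : X => γ • x)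
    (φ : SL(n, ℝ) ⧸ B → X) (hφcont : Continuous φ) (hφsurj : Function.Surjective φ)
    (hφequiv : ∀ (γ : SLZ n) (x : SL(n, ℝ) ⧸ B), φ ((γ : SL(n, ℝ)) • x) = γ • φ x) :
    ∃ P : Subgroup (SL(n, ℝ)), B ≤ P ∧ IsClosed (P : Set (SL(n, ℝ))) ∧
      ∃ e : (SL(n, ℝ) ⧸ P) ≃ₜ X,
        ∀ (γ : SLZ n) (x : SL(n, ℝ) ⧸ P), e ((γ : SL(n, ℝ)) • x) = γ • e x := by
  have hB' : ∀ g : SL(n, ℝ), g ∈ B ↔ Dani.UT g := hB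
  refine ⟨Dani.PP φ, Dani.B_le_PP φ, Dani.isClosed_PP hφcont, ?_⟩
  have hcpt : CompactSpace (SL(n, ℝ) ⧸ Dani.PP φ) := by
    have := Dani.compactSpace_quot B hB
    have hs : Function.Surjective (Subgroup.quotientMapOfLE (Dani.B_le_PP φ)) := by
      intro y
      induction y using QuotientGroup.induction_on with
      | H b => exact ⟨QuotientGroup.mk b, rfl⟩
    refine hs.compactSpace ?_
    refine isQuotientMap_quotient_mk'.continuous_iff.mpr ?_
    exact QuotientGroup.continuous_mk
  have hwd : ∀ a b : SL(n, ℝ), (QuotientGroup.leftRel (Dani.PP φ)) a b →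
      φ (QuotientGroup.mk a) = φ (QuotientGroup.mk b) := by
    intro a b hab
    have h1 : a⁻¹ * b ∈ Dani.PP φ := QuotientGroup.leftRel_apply.mp hab
    have h2 := (Dani.mem_PP φ _).mp h1 a
    rw [mul_inv_cancel_left] at h2
    exact h2.symm
  let f : SL(n, ℝ) ⧸ Dani.PP φ → X := Quotient.lift (fun g => φ (QuotientGroup.mk g)) hwd
  have hfmk : ∀ g : SL(n, ℝ), f (QuotientGroup.mk g) = φ (QuotientGroup.mk g) := fun g => rfl
  have hfc : Continuous f := Continuous.quotient_lift (hφcont.comp QuotientGroup.continuous_mk) hwd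
  have hinj : Function.Injective f := by
    intro x y
    induction x using QuotientGroup.induction_on with
    | H a =>
    induction y using QuotientGroup.induction_on with
    | H b =>
    intro hab
    rw [hfmk, hfmk] at hab
    rw [QuotientGroup.eq]
    apply Dani.mem_PP_of hn hB' φ hφcont hφequiv (g := a)
    rw [mul_inv_cancel_left]
    exact hab
  have hsurj : Function.Surjective f := by
    intro x
    obtain ⟨y, rfl⟩ := hφsurj x
    induction y using QuotientGroup.induction_on with
    | H b => exact ⟨QuotientGroup.mk b, rfl⟩
  refine ⟨Continuous.homeoOfEquivCompactToT2 (f := Equiv.ofBijective f ⟨hinj, hsurj⟩) hfc, ?_⟩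
  intro γ x
  show f ((γ : SL(n, ℝ)) • x) = γ • f x
  induction x using QuotientGroup.induction_on with
  | H b => exact hφequiv γ (QuotientGroup.mk b)
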